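/- arXiv:1405.1687 — 3 statements merged into one kernel-verified Lean document; each statement's English description precedes it below -/
import Mathlib

section
/- Every smooth lattice polytope P ⊂ ℝ^d whose only lattice points are its vertices (P ∩ ℤ^d = vertices(P)) is lattice equivalent to a product of unimodular simplices. -/
/-- `x` is a point of the standard lattice `ℤ^d ⊆ ℝ^d`. -/
def Zd {d : ℕ} (x : Fin d → ℝ) : Prop := ∀ i, ∃ z : ℤ, x i = (z : ℝ)

/-- `x` lies in the affine lattice generated (over `ℤ`) by the finite point set `F`. -/
def InAffLat {E : Type*} [AddCommGroup E] [Module ℝ E] (F : Finset E) (x : E) : Prop :=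
  ∃ c : E → ℤ, (∀ a, a ∉ F → c a = 0) ∧ (∑ a ∈ F, c a) = 1 ∧ (∑ a ∈ F, (c a : ℝ) • a) = x

/-- `F` is the vertex set of a unimodular simplex with respect to the lattice predicate `L`:
its vertices are affinely independent lattice points which affinely generate every lattice
point of their affine span. -/
def UnimodularFinset {E : Type*} [AddCommGroup E] [Module ℝ E] (L : E → Prop)
    (F : Finset E) : Prop :=
  (∀ a ∈ F, L a) ∧ AffineIndependent ℝ (fun p : F => (p : E)) ∧
    ∀ x, L x → x ∈ affineSpan ℝ (F : Set E) → InAffLat F x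

/-- A (geometric) triangulation of the set `P`, recorded by the vertex sets of its faces:
faces are affinely independent, the collection is closed under taking subsets, convex hulls
of faces intersect in the convex hull of the common vertices, and the faces cover `P`. -/
def IsTriangulation {E : Type*} [AddCommGroup E] [Module ℝ E]
    (P : Set E) (T : Finset (Finset E)) : Prop :=
  (∀ F ∈ T, AffineIndependent ℝ (fun p : F => (p : E))) ∧
  (∀ F ∈ T, ∀ G, G ⊆ F → G ∈ T) ∧
  (∀ F ∈ T, ∀ G ∈ T,
    convexHull ℝ (F : Set E) ∩ convexHull ℝ (G : Set E) =
      convexHull ℝ ((F : Set E) ∩ (G : Set E))) ∧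
  (⋃ F ∈ T, convexHull ℝ (F : Set E)) = P

/-- `F` is a maximal cell of the triangulation `T`. -/
def MaxCell {E : Type*} (T : Finset (Finset E)) (F : Finset E) : Prop :=
  F ∈ T ∧ ∀ G ∈ T, F ⊆ G → G = F

/-- A triangulation is unimodular when all of its maximal cells are unimodular simplices. -/
def IsUnimodular {E : Type*} [AddCommGroup E] [Module ℝ E] (L : E → Prop)
    (T : Finset (Finset E)) : Prop :=
  ∀ F, MaxCell T F → UnimodularFinset L F

/-- A triangulation is regular when its maximal cells are the domains of linearity of a
piecewise linear convex function on `P`. -/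
def IsRegularTri {E : Type*} [AddCommGroup E] [Module ℝ E]
    (P : Set E) (T : Finset (Finset E)) : Prop :=
  ∃ f : E → ℝ, ConvexOn ℝ P f ∧
    (∀ F, MaxCell T F → ∃ g : E →ᵃ[ℝ] ℝ, Set.EqOn f (⇑g) (convexHull ℝ (F : Set E))) ∧
    (∀ F G, MaxCell T F → MaxCell T G → F ≠ G →
      ¬ ∃ g : E →ᵃ[ℝ] ℝ,
        Set.EqOn f (⇑g) (convexHull ℝ (F : Set E) ∪ convexHull ℝ (G : Set E)))

/-- `N` is a minimal non-face of the triangulation `T`: a set of vertices of `T` which is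
not a face, all of whose proper subsets are faces. -/
def MinNonFace {E : Type*} (T : Finset (Finset E)) (N : Finset E) : Prop :=
  (∀ x ∈ N, ({x} : Finset E) ∈ T) ∧ N ∉ T ∧ ∀ M, M ⊂ N → M ∈ T

/-- A triangulation is flag when all of its minimal non-faces have exactly two elements. -/
def IsFlag {E : Type*} (T : Finset (Finset E)) : Prop :=
  ∀ N, MinNonFace T N → N.card = 2

/-- A triangulation of `P` is full when every lattice point of `P` is one of its vertices. -/
def IsFull {E : Type*} (L : E → Prop) (P : Set E) (T : Finset (Finset E)) : Prop :=
  ∀ x ∈ P, L x → ({x} : Finset E) ∈ T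

/-- `P` is a lattice polytope with respect to the lattice predicate `L`. -/
def IsLatticePolytope {E : Type*} [AddCommGroup E] [Module ℝ E] (L : E → Prop)
    (P : Set E) : Prop :=
  ∃ V : Finset E, V.Nonempty ∧ (∀ v ∈ V, L v) ∧ P = convexHull ℝ (V : Set E)

/-- `F` is a face of the convex set `Q` (the improper face `Q` and the empty face included),
cut out by a linear functional maximized on `Q` along `F`. -/
def FaceOf {E : Type*} [AddCommGroup E] [Module ℝ E] (Q F : Set E) : Prop :=
  F = Q ∨ ∃ (l : E →ₗ[ℝ] ℝ) (c : ℝ), (∀ x ∈ Q, l x ≤ c) ∧ F = {x ∈ Q | l x = c}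

/-- `v` is a vertex of the polytope `P`. -/
def IsVertexOf {E : Type*} [AddCommGroup E] [Module ℝ E] (P : Set E) (v : E) : Prop :=
  FaceOf P {v}

/-- The segment `[v, w]` is an edge of the polytope `P`. -/
def IsEdgeOf {E : Type*} [AddCommGroup E] [Module ℝ E] (P : Set E) (v w : E) : Prop :=
  v ≠ w ∧ FaceOf P (segment ℝ v w)

/-- A full-dimensional lattice polytope `P ⊆ ℝ^d` is smooth: it is simple (each vertex has
exactly `d` neighbours) and at every vertex the primitive integral direction vectors of
the incident edges form a basis of `ℤ^d` (a `±1`-determinant matrix). -/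
def IsSmooth {d : ℕ} (P : Set (Fin d → ℝ)) : Prop :=
  ∀ v, IsVertexOf P v →
    ∃ w : Fin d → (Fin d → ℝ),
      (∀ i, IsVertexOf P (w i) ∧ IsEdgeOf P v (w i)) ∧
      (∀ u, IsVertexOf P u → IsEdgeOf P v u → ∃ i, u = w i) ∧
      ∃ m : Fin d → (Fin d → ℤ),
        (∀ i, ∃ k : ℕ, 0 < k ∧ w i - v = fun j => (k : ℝ) * (m i j : ℝ)) ∧
        (Matrix.of fun i j => m i j).det ∈ ({1, -1} : Set ℤ)

section ConvexGeometry

variable {E : Type*} [AddCommGroup E] [Module ℝ E]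

theorem IsVertexOf.mem_extremePoints {P : Set E} {v : E} (h : IsVertexOf P v) :
    v ∈ P.extremePoints ℝ := by
  rcases h with h | ⟨l, c, hl, h⟩
  · rw [← h]; simp
  · have hv : v ∈ P ∧ l v = c := by
      have : v ∈ ({v} : Set E) := rfl
      rw [h] at this; exact this
    refine ⟨hv.1, fun x hx y hy hxy => ?_⟩
    obtain ⟨a, b, ha, hb, hab, rfl⟩ := hxy
    have h1 := hl x hx
    have h2 := hl y hy
    have h3 := hv.2
    simp only [map_add, map_smul, smul_eq_mul] at h3
    have hx' : l x = c := by
      by_contra hne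
      have : l x < c := lt_of_le_of_ne h1 hne
      have : a * l x + b * l y < a * c + b * c := by
        have := mul_lt_mul_of_pos_left this ha
        have := mul_le_mul_of_nonneg_left h2 hb.le
        linarith
      rw [← add_mul, hab] at this
      linarith
    have : x ∈ ({a • x + b • y} : Set E) := by rw [h]; exact ⟨hx, hx'⟩
    exact this

/-- A point of `P` in the open segment between two points of `P` is not extreme. -/
theorem eq_of_mem_extremePoints {P : Set E} {x y : E} {t : ℝ} (hx : x ∈ P) (hy : y ∈ P)
    (ht0 : 0 < t) (ht1 : t < 1) (h : x + t • (y - x) ∈ P.extremePoints ℝ) : x = y := by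
  have hmem : x + t • (y - x) ∈ openSegment ℝ x y :=
    ⟨1 - t, t, by linarith, ht0, by ring, by module⟩
  have h' := (mem_extremePoints.1 h).2 x hx y hy hmem
  exact h'.1.trans h'.2.symm

theorem IsVertexOf.exists_linear_lt {P : Set E} {v : E} (h : IsVertexOf P v) :
    ∃ l : E →ₗ[ℝ] ℝ, ∀ u ∈ P, u ≠ v → l u < l v := by
  rcases h with h | ⟨l, c, hl, h⟩
  · exact ⟨0, fun u hu hne => absurd (by rw [← h] at hu; exact hu) hne⟩
  · have hv : v ∈ P ∧ l v = c := by
      have : v ∈ ({v} : Set E) := rfl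
      rw [h] at this; exact this
    refine ⟨l, fun u hu hne => ?_⟩
    rw [hv.2]
    refine lt_of_le_of_ne (hl u hu) fun hc => hne ?_
    have : u ∈ ({v} : Set E) := by rw [h]; exact ⟨hu, hc⟩
    exact this

theorem mem_convexHull_of_linear_max {V : Finset E} {h : E →ₗ[ℝ] ℝ} {c : ℝ}
    (hle : ∀ u ∈ V, h u ≤ c) {x : E} (hx : x ∈ convexHull ℝ (V : Set E)) (hxc : h x = c) :
    x ∈ convexHull ℝ {u | u ∈ V ∧ h u = c} := by
  rw [Finset.mem_convexHull'] at hx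
  obtain ⟨w, hw0, hw1, hwx⟩ := hx
  have key : ∀ u ∈ V, w u * (c - h u) = 0 := by
    rw [← Finset.sum_eq_zero_iff_of_nonneg
      fun u hu => mul_nonneg (hw0 u hu) (sub_nonneg.2 (hle u hu))]
    simp only [mul_sub, Finset.sum_sub_distrib]
    rw [← Finset.sum_mul, hw1, ← hxc, ← hwx, map_sum]
    simp
  have hne : ∑ u ∈ V with w u ≠ 0, w u = 1 := by rw [Finset.sum_filter_ne_zero, hw1]
  have hxs : ∑ u ∈ V with w u ≠ 0, w u • u = x := by
    rw [← hwx]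
    refine Finset.sum_filter_of_ne fun u _ hu h0 => hu ?_
    rw [h0, zero_smul]
  rw [← hxs]
  refine (convex_convexHull ℝ _).sum_mem (fun u hu => hw0 u (Finset.mem_filter.1 hu).1) hne
    fun u hu => subset_convexHull ℝ _ ?_
  rw [Finset.mem_filter] at hu
  refine ⟨hu.1, ?_⟩
  have := (mul_eq_zero.1 (key u hu.1)).resolve_left hu.2
  linarith

variable [TopologicalSpace E] [T2Space E] [IsTopologicalAddGroup E] [ContinuousSMul ℝ E]
  [LocallyConvexSpace ℝ E] [FiniteDimensional ℝ E]

/-- A linear functional that does not decrease along the edges at the vertex `v` attains its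
minimum over the polytope at `v`. -/
theorem le_of_forall_isEdgeOf_le {P : Set E} {V : Finset E} (hP : P = convexHull ℝ (V : Set E))
    (hV : ∀ u ∈ V, IsVertexOf P u) {v : E} (hv : v ∈ V) (φ : E →ₗ[ℝ] ℝ)
    (hφ : ∀ u, IsVertexOf P u → IsEdgeOf P v u → φ v ≤ φ u) : ∀ x ∈ P, φ v ≤ φ x := by
  classical
  have hVP : ∀ u ∈ V, u ∈ P := fun u hu => by rw [hP]; exact subset_convexHull ℝ _ hu
  have hconv : Convex ℝ P := by rw [hP]; exact convex_convexHull ℝ _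
  obtain ⟨l, hl⟩ := (hV v hv).exists_linear_lt
  let q : E → E := fun u => (l v - l u)⁻¹ • (u - v)
  let A : Set E := q '' {u | u ∈ V ∧ u ≠ v}
  have hAfin : A.Finite := (V.finite_toSet.subset fun u hu => hu.1).image _
  have hlpos : ∀ u ∈ V, u ≠ v → 0 < l v - l u := fun u hu hne =>
    sub_pos.2 (hl u (hVP u hu) hne)
  have hext : (convexHull ℝ A).extremePoints ℝ ⊆ {y | 0 ≤ φ y} := by
    intro p hp
    obtain ⟨u, ⟨huV, huv⟩, hup⟩ := extremePoints_convexHull_subset hp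
    have hpq : (l v - l u) • p = u - v := by
      rw [← hup]; exact smul_inv_smul₀ (hlpos u huV huv).ne' _
    have hnot : p ∉ convexHull ℝ (A \ {p}) := by
      have hc := ((convex_convexHull ℝ A).mem_extremePoints_iff_convex_sdiff.1 hp).2
      have hsub : convexHull ℝ (A \ {p}) ⊆ convexHull ℝ A \ {p} :=
        convexHull_min (Set.sdiff_subset_sdiff_left (subset_convexHull ℝ A)) hc
      exact fun hmem => (hsub hmem).2 rfl
    obtain ⟨g, s, hgp, hgs⟩ := geometric_hahn_banach_point_closed (convex_convexHull ℝ (A \ {p}))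
      ((hAfin.subset Set.sdiff_subset).isClosed_convexHull ℝ) hnot
    let h : E →ₗ[ℝ] ℝ := -((g : E →ₗ[ℝ] ℝ) + g p • l)
    have hh : ∀ x, h x = -(g x + g p * l x) := fun x => rfl
    have hhu : ∀ u' ∈ V, h u' ≤ h v ∧ (h u' = h v → u' = v ∨ q u' = p) := by
      intro u' hu'
      by_cases hne : u' = v
      · simp [hne]
      have hpos := hlpos u' hu' hne
      have hg : g u' - g v = (l v - l u') * g (q u') := by
        simp only [q, map_smul, smul_eq_mul, map_sub]
        field_simp
      by_cases hqp : q u' = p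
      · rw [hqp] at hg
        refine ⟨?_, fun _ => Or.inr hqp⟩
        rw [hh, hh]; linarith
      · have : g p < g (q u') := hgp.trans
          (hgs _ (subset_convexHull ℝ _ ⟨⟨u', ⟨hu', hne⟩, rfl⟩, hqp⟩))
        have := mul_lt_mul_of_pos_left this hpos
        have hlt : h u' < h v := by rw [hh, hh]; linarith
        exact ⟨hlt.le, fun h => absurd h hlt.ne⟩
    have hhuv : h u = h v := by
      have : g u - g v = (l v - l u) * g p := by
        rw [← map_sub, ← hpq]; simp
      rw [hh, hh]; linarith
    have hsub : {u' | u' ∈ V ∧ h u' = h v} ⊆ {v, u} := by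
      rintro u' ⟨hu', heq⟩
      rcases (hhu u' hu').2 heq with rfl | hqp
      · simp
      by_cases huv' : u' = v
      · simp [huv']
      right
      have h1 : (l v - l u') • p = u' - v := by
        rw [← hqp]; exact smul_inv_smul₀ (hlpos u' hu' huv').ne' _
      have key : ∀ a b : E, a ∈ V → b ∈ V → a ≠ v → b ≠ v → (l v - l a) • p = a - v →
          (l v - l b) • p = b - v → ¬ l v - l a < l v - l b := by
        intro a b ha hb hav hbv hqa hqb hlt
        have hla := hlpos a ha hav
        have hlb := hlpos b hb hbv
        refine hbv (eq_of_mem_extremePoints (t := (l v - l a) / (l v - l b)) (hVP v hv)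
          (hVP b hb) (by positivity) ((div_lt_one hlb).2 hlt) ?_).symm
        rw [← hqb, smul_smul, div_mul_cancel₀ _ hlb.ne', hqa, add_sub_cancel]
        exact (hV a ha).mem_extremePoints
      have h2 : l v - l u' = l v - l u :=
        le_antisymm (not_lt.1 (key u u' huV hu' huv huv' hpq h1))
          (not_lt.1 (key u' u hu' huV huv' huv h1 hpq))
      rw [h2, hpq] at h1
      exact (sub_left_injective h1).symm
    have hedge : IsEdgeOf P v u := by
      refine ⟨huv.symm, Or.inr ⟨h, h v, ?_, ?_⟩⟩
      · intro x hx
        rw [hP] at hx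
        exact convexHull_min (fun u' hu' => (hhu u' hu').1)
          (convex_halfSpace_le h.isLinear (h v)) hx
      · ext x
        constructor
        · intro hx
          refine ⟨hconv.segment_subset (hVP v hv) (hVP u huV) hx, ?_⟩
          obtain ⟨a, b, _, _, hab, rfl⟩ := hx
          rw [map_add, map_smul, map_smul, hhuv, ← add_smul, hab, one_smul]
        · rintro ⟨hx, hxv⟩
          rw [hP] at hx
          have := convexHull_mono hsub (mem_convexHull_of_linear_max (fun u' hu' => (hhu u' hu').1)
            hx hxv)
          rwa [convexHull_pair] at this
    have h0 := hφ u (hV u huV) hedge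
    have h1 : φ u - φ v = (l v - l u) * φ p := by rw [← map_sub, ← hpq]; simp
    by_contra hneg
    have := mul_neg_of_pos_of_neg (hlpos u huV huv) (not_le.1 hneg)
    linarith
  have hA : A ⊆ {y | 0 ≤ φ y} := by
    refine (subset_convexHull ℝ A).trans ?_
    rw [← closure_convexHull_extremePoints (hAfin.isCompact_convexHull ℝ) (convex_convexHull ℝ A)]
    exact closure_minimal (convexHull_min hext (convex_halfSpace_ge φ.isLinear 0))
      (isClosed_le continuous_const φ.continuous_of_finiteDimensional)
  intro x hx
  rw [hP] at hx
  refine convexHull_min (fun u hu => ?_) (convex_halfSpace_ge φ.isLinear (φ v)) hx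
  by_cases hne : u = v
  · simp [hne]
  have h0 : 0 ≤ φ (q u) := hA ⟨u, ⟨hu, hne⟩, rfl⟩
  have h1 : φ u - φ v = (l v - l u) * φ (q u) := by
    have := (hlpos u hu hne).ne'
    simp only [q, map_smul, smul_eq_mul, map_sub]
    field_simp
  have := mul_nonneg (hlpos u hu hne).le h0
  change φ v ≤ φ u
  linarith

end ConvexGeometry

section Lattice

variable {d : ℕ}

theorem Zd.add {x y : Fin d → ℝ} (hx : Zd x) (hy : Zd y) : Zd (x + y) := fun i => by
  obtain ⟨a, ha⟩ := hx i
  obtain ⟨b, hb⟩ := hy i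
  exact ⟨a + b, by simp [ha, hb]⟩

theorem Zd.neg {x : Fin d → ℝ} (hx : Zd x) : Zd (-x) := fun i => by
  obtain ⟨a, ha⟩ := hx i
  exact ⟨-a, by simp [ha]⟩

theorem Zd.sub {x y : Fin d → ℝ} (hx : Zd x) (hy : Zd y) : Zd (x - y) := by
  rw [sub_eq_add_neg]; exact hx.add hy.neg

theorem Zd.sub_iff {x y : Fin d → ℝ} (hy : Zd y) : Zd (x - y) ↔ Zd x :=
  ⟨fun h => by simpa using h.add hy, fun h => h.sub hy⟩

theorem zd_zero : Zd (0 : Fin d → ℝ) := fun _ => ⟨0, by simp⟩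

theorem zd_single (i : Fin d) : Zd (Pi.single i 1 : Fin d → ℝ) := fun j => by
  by_cases h : j = i
  · subst h; exact ⟨1, by simp⟩
  · exact ⟨0, by simp [h]⟩

/-- Convex sets whose lattice points are extreme, and whose tangent cone at each lattice point
is spanned by a lattice basis of vectors pointing to further lattice points of the set. -/
structure EmptySmooth (P : Set (Fin d → ℝ)) : Prop where
  convex : Convex ℝ P
  extreme : ∀ x ∈ P, Zd x → x ∈ P.extremePoints ℝ
  chart : ∀ v ∈ P, Zd v → ∃ N : (Fin d → ℝ) ≃ₗ[ℝ] (Fin d → ℝ), (∀ x, Zd x ↔ Zd (N x)) ∧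
    (∀ x ∈ P, ∀ k, 0 ≤ N (x - v) k) ∧ ∀ k, v + N.symm (Pi.single k 1) ∈ P

/-- Sets in the nonnegative orthant containing the vertices of the standard simplex. -/
structure IsCornered (P : Set (Fin d → ℝ)) : Prop where
  zero_mem : 0 ∈ P
  single_mem : ∀ i, Pi.single i 1 ∈ P
  nonneg : ∀ x ∈ P, ∀ i, 0 ≤ x i

/-- Two coordinates are linked when the sum of the corresponding unit vectors leaves `P`. -/
def Linked (P : Set (Fin d → ℝ)) (i j : Fin d) : Prop :=
  j = i ∨ (Pi.single i 1 + Pi.single j 1 : Fin d → ℝ) ∉ P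

theorem linear_apply_eq_sum (f : (Fin d → ℝ) →ₗ[ℝ] (Fin d → ℝ)) (x : Fin d → ℝ) (k : Fin d) :
    f x k = ∑ l, x l * f (Pi.single l 1) k := by
  conv_lhs => rw [pi_eq_sum_univ' x, map_sum]
  simp [Finset.sum_apply]

theorem EmptySmooth.image {P : Set (Fin d → ℝ)} (hP : EmptySmooth P)
    (f : (Fin d → ℝ) ≃ᵃ[ℝ] (Fin d → ℝ)) (hf : ∀ x, Zd x ↔ Zd (f x)) :
    EmptySmooth (f '' P) where
  convex := hP.convex.affine_image f.toAffineMap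
  extreme := by
    rintro _ ⟨x, hx, rfl⟩ hz
    have hext := hP.extreme x hx ((hf x).2 hz)
    refine ⟨⟨x, hx, rfl⟩, ?_⟩
    rintro _ ⟨a, ha, rfl⟩ _ ⟨b, hb, rfl⟩ hab
    have : f x ∈ f.toAffineMap '' openSegment ℝ a b := by
      rw [image_openSegment]; exact hab
    obtain ⟨y, hy, hyx⟩ := this
    have hyx' : y = x := f.injective hyx
    subst hyx'
    rw [hext.2 ha hb hy]
  chart := by
    rintro _ ⟨v, hv, rfl⟩ hz
    obtain ⟨N, hN, hpos, hmem⟩ := hP.chart v hv ((hf v).2 hz)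
    have hlin : ∀ x y, f.linear (x - y) = f x - f y := fun x y => f.toAffineMap.linearMap_vsub x y
    have hlin' : ∀ x, f.linear x = f x - f 0 := fun x => by rw [← hlin, sub_zero]
    have hzlin : ∀ x, Zd x ↔ Zd (f.linear x) := fun x => by
      rw [hlin', Zd.sub_iff ((hf 0).1 zd_zero), hf x]
    refine ⟨f.linear.symm.trans N, fun x => ?_, ?_, fun k => ⟨_, hmem k, ?_⟩⟩
    · rw [LinearEquiv.trans_apply, ← hN, hzlin (f.linear.symm x), LinearEquiv.apply_symm_apply]
    · rintro _ ⟨x, hx, rfl⟩ k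
      rw [← hlin, LinearEquiv.trans_apply, LinearEquiv.symm_apply_apply]
      exact hpos x hx k
    · have := f.map_vadd v (N.symm (Pi.single k 1))
      simp only [vadd_eq_add] at this
      rw [add_comm v, this, add_comm]
      rfl

theorem Int.eq_neg_one_of_mul_eq_one_of_neg {a b : ℤ} (h : a * b = 1) (ha : a < 0) : a = -1 := by
  rcases Int.eq_one_or_neg_one_of_mul_eq_one h with h | h <;> omega

/-- The facet inequality of the class of `i`. -/
theorem EmptySmooth.sum_linked_le_one {P : Set (Fin d → ℝ)} (hP : EmptySmooth P)
    (hC : IsCornered P) (i : Fin d) {x : Fin d → ℝ} (hx : x ∈ P) [DecidablePred (Linked P i)] :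
    ∑ l with Linked P i l, x l ≤ 1 := by
  obtain ⟨N, hN, hpos, hmem⟩ := hP.chart _ (hC.single_mem i) (zd_single i)
  set m : Fin d → Fin d → ℝ := fun k => N.symm (Pi.single k 1)
  have hNm : ∀ k, N (m k) = Pi.single k 1 := fun k => N.apply_symm_apply _
  have hmint : ∀ k, Zd (m k) := fun k => by rw [hN, hNm]; exact zd_single k
  have hmnonneg : ∀ k l, l ≠ i → 0 ≤ m k l := fun k l hl => by
    have := hC.nonneg _ (hmem k) l
    simpa [hl] using this
  have hexp : ∀ y l, y l = ∑ k, N y k * m k l := fun y l => by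
    have := linear_apply_eq_sum N.symm.toLinearMap (N y) l
    simpa using this
  have hp : ∀ k, 0 ≤ N (-Pi.single i 1) k := fun k => by
    simpa using hpos 0 hC.zero_mem k
  -- the edge from `single i 1` back to the origin
  obtain ⟨k₀, hk₀⟩ : ∃ k, N (-Pi.single i 1) k ≠ 0 := by
    by_contra! h
    have h0 : N (-Pi.single i 1) = 0 := funext h
    rw [N.map_eq_zero_iff] at h0
    have := congrFun h0 i
    simp at this
  have hmk₀ : ∀ l, l ≠ i → m k₀ l = 0 := fun l hl => by
    have h1 := hexp (-Pi.single i 1) l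
    simp only [Pi.neg_apply, Pi.single_eq_of_ne hl, neg_zero] at h1
    have h2 := (Finset.sum_eq_zero_iff_of_nonneg
      fun k _ => mul_nonneg (hp k) (hmnonneg k l hl)).1 h1.symm k₀ (Finset.mem_univ _)
    exact (mul_eq_zero.1 h2).resolve_left hk₀
  have hNi : N (Pi.single i 1) k₀ = -1 := by
    have h1 := linear_apply_eq_sum N.toLinearMap (m k₀) k₀
    rw [Finset.sum_eq_single i (fun l _ hl => by rw [hmk₀ l hl, zero_mul]) (by simp)] at h1
    simp only [LinearEquiv.coe_coe, hNm, Pi.single_eq_same] at h1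
    obtain ⟨a, ha⟩ := (hN _).1 (zd_single i) k₀
    obtain ⟨b, hb⟩ := hmint k₀ i
    have hneg : N (Pi.single i 1) k₀ < 0 := by
      have := lt_of_le_of_ne (hp k₀) hk₀.symm
      simpa using this
    rw [ha, hb] at h1
    rw [ha] at hneg ⊢
    have h2 : a * b = 1 := by rw [mul_comm]; exact_mod_cast h1.symm
    have := Int.eq_neg_one_of_mul_eq_one_of_neg h2 (by exact_mod_cast hneg)
    simp [this]
  -- the edges from `single i 1` in the remaining coordinate directions
  have hNj : ∀ j, j ≠ i → N (Pi.single j 1) k₀ ≤ 0 ∧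
      (Linked P i j → N (Pi.single j 1) k₀ ≤ -1) := by
    intro j hj
    set q := N (Pi.single j 1 - Pi.single i 1) with hq_def
    have hq : ∀ k, 0 ≤ q k := hpos _ (hC.single_mem j)
    have hqint : Zd q := (hN _).1 ((zd_single j).sub (zd_single i))
    have hsum : ∀ l, l ≠ i → ∑ k, q k * m k l = if l = j then 1 else 0 := fun l hl => by
      rw [hq_def, ← hexp]
      simp [hl, Pi.single_apply]
    obtain ⟨k, hk⟩ : ∃ k, q k * m k j ≠ 0 := by
      by_contra! h
      have := hsum j hj
      simp [h] at this
    have hqk : q k ≠ 0 := left_ne_zero_of_mul hk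
    have hmkj : m k j = 1 := by
      have hle : q k * m k j ≤ 1 := by
        have := Finset.single_le_sum (fun k _ => mul_nonneg (hq k) (hmnonneg k j hj))
          (Finset.mem_univ k)
        rwa [hsum j hj, if_pos rfl] at this
      have h0 := lt_of_le_of_ne (hq k) hqk.symm
      have h1 := lt_of_le_of_ne (hmnonneg k j hj) (right_ne_zero_of_mul hk).symm
      obtain ⟨a, ha⟩ := hqint k
      obtain ⟨b, hb⟩ := hmint k j
      rw [ha, hb] at hle
      rw [ha] at h0
      rw [hb] at h1 ⊢
      norm_cast at *
      nlinarith
    have hmkl : ∀ l, l ≠ i → l ≠ j → m k l = 0 := fun l hl hlj => by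
      have h1 := hsum l hl
      rw [if_neg hlj] at h1
      have h2 := (Finset.sum_eq_zero_iff_of_nonneg
        fun k _ => mul_nonneg (hq k) (hmnonneg k l hl)).1 h1 k (Finset.mem_univ _)
      exact (mul_eq_zero.1 h2).resolve_left hqk
    have hkk₀ : k ≠ k₀ := by
      rintro rfl
      rw [hmk₀ j hj] at hmkj
      exact zero_ne_one hmkj
    have hmk : m k = Pi.single j 1 + m k i • Pi.single i 1 := by
      ext l
      by_cases hl : l = i
      · subst hl; simp [hj.symm]
      by_cases hlj : l = j
      · subst hlj; simp [hl, hmkj]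
      · simp [hl, hlj, hmkl l hl hlj]
    have hNt : N (Pi.single j 1) k₀ = m k i := by
      have h1 := congrFun (congrArg N hmk) k₀
      rw [hNm, map_add, map_smul, Pi.add_apply, Pi.smul_apply, hNi,
        Pi.single_eq_of_ne hkk₀.symm] at h1
      simp only [smul_eq_mul] at h1
      linarith
    have hmemk : Pi.single j 1 + (1 + m k i) • Pi.single i 1 ∈ P := by
      have h1 := hmem k
      change _ + m k ∈ P at h1
      have h2 : (Pi.single i 1 : Fin d → ℝ) + m k = Pi.single j 1 + (1 + m k i) • Pi.single i 1 := by
        conv_lhs => rw [hmk]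
        module
      rwa [← h2]
    obtain ⟨t, ht⟩ := hmint k i
    rw [hNt]
    have hle : m k i ≤ 0 := by
      by_contra! hpos
      have h1 : (0 : ℝ) < 1 + m k i := by linarith
      have h2 : Pi.single j 1 + (1 + m k i)⁻¹ •
          ((Pi.single j 1 + (1 + m k i) • Pi.single i 1) - Pi.single j 1) =
          (Pi.single j 1 + Pi.single i 1 : Fin d → ℝ) := by
        rw [add_sub_cancel_left, inv_smul_smul₀ h1.ne']
      have hlt : (1 + m k i)⁻¹ < 1 := inv_lt_one_of_one_lt₀ (by linarith)
      have hmem' := hP.convex.add_smul_sub_mem (hC.single_mem j) hmemk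
        ⟨(inv_pos.2 h1).le, hlt.le⟩
      rw [h2] at hmem'
      have hext := hP.extreme _ hmem' ((zd_single j).add (zd_single i))
      rw [← h2] at hext
      have := eq_of_mem_extremePoints (hC.single_mem j) hmemk (inv_pos.2 h1) hlt hext
      have := congrFun this i
      simp [hj.symm] at this
      linarith
    refine ⟨hle, fun hlink => ?_⟩
    have hne : m k i ≠ 0 := fun h0 => by
      rw [h0, add_zero, one_smul, add_comm] at hmemk
      exact hlink.elim hj fun h => h hmemk
    rw [ht] at hle hne ⊢
    norm_cast at *
    omega
  have hfin := hpos x hx k₀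
  rw [map_sub, Pi.sub_apply, hNi] at hfin
  have hNx : N x k₀ = ∑ l, x l * N (Pi.single l 1) k₀ := linear_apply_eq_sum N.toLinearMap x k₀
  have hbound : N x k₀ ≤ ∑ l, -(if Linked P i l then x l else 0) := by
    rw [hNx]
    refine Finset.sum_le_sum fun l _ => ?_
    have hxl := hC.nonneg x hx l
    by_cases hl : l = i
    · subst hl
      rw [if_pos (show Linked P l l from Or.inl rfl), hNi]
      linarith
    · obtain ⟨h1, h2⟩ := hNj l hl
      split_ifs with hlink
      · nlinarith [h2 hlink]
      · nlinarith
  rw [Finset.sum_neg_distrib, ← Finset.sum_filter] at hbound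
  linarith

theorem Linked.refl (P : Set (Fin d → ℝ)) (i : Fin d) : Linked P i i := Or.inl rfl

theorem Linked.symm {P : Set (Fin d → ℝ)} {i j : Fin d} (h : Linked P i j) : Linked P j i :=
  h.imp Eq.symm fun h => by rwa [add_comm]

theorem EmptySmooth.add_le_one {P : Set (Fin d → ℝ)} (hP : EmptySmooth P)
    (hC : IsCornered P) {i a b : Fin d} {x : Fin d → ℝ} (hx : x ∈ P) (ha : Linked P i a)
    (hb : Linked P i b) (hab : a ≠ b) : x a + x b ≤ 1 := by
  classical
  refine le_trans ?_ (hP.sum_linked_le_one hC i hx)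
  rw [← Finset.sum_pair hab]
  refine Finset.sum_le_sum_of_subset_of_nonneg ?_ fun l _ _ => hC.nonneg x hx l
  intro l hl
  rcases Finset.mem_insert.1 hl with rfl | hl
  · simpa using ha
  · rw [Finset.mem_singleton.1 hl]
    simpa using hb

theorem EmptySmooth.linked_trans {P : Set (Fin d → ℝ)} (hP : EmptySmooth P)
    (hC : IsCornered P) {i j k : Fin d} (hij : Linked P i j) (hjk : Linked P j k) :
    Linked P i k := by
  by_contra h
  rw [Linked, not_or, not_not] at h
  have := hP.add_le_one hC h.2 hij.symm hjk (Ne.symm h.1)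
  simp [h.1, Ne.symm h.1] at this
  norm_num at this

open Classical in
/-- The affine involution exchanging the corner at the origin with the one at `single i 1`. -/
noncomputable def cornerSwap (P : Set (Fin d → ℝ)) (i : Fin d) :
    (Fin d → ℝ) ≃ᵃ[ℝ] (Fin d → ℝ) :=
  (LinearEquiv.ofInvolutive
    ({ toFun := fun x => Function.update x i (-∑ l with Linked P i l, x l)
       map_add' := fun x y => by
        ext k
        by_cases hk : k = i
        · subst hk
          simp [Finset.sum_add_distrib, add_comm]
        · simp [hk]
       map_smul' := fun a x => by
        ext k
        by_cases hk : k = i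
        · subst hk
          simp [Finset.mul_sum]
        · simp [hk] } : (Fin d → ℝ) →ₗ[ℝ] (Fin d → ℝ))
    (fun x => by
      ext k
      by_cases hk : k = i
      · subst hk
        have hmem : k ∈ Finset.univ.filter (Linked P k) := by simp [Linked.refl]
        simp only [LinearMap.coe_mk, AddHom.coe_mk, Function.update_self]
        rw [Finset.sum_update_of_mem hmem, Finset.sdiff_singleton_eq_erase,
          ← Finset.add_sum_erase _ _ hmem]
        ring
      · simp [hk])).toAffineEquiv.trans
    (AffineEquiv.constVAdd ℝ (Fin d → ℝ) (Pi.single i 1))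

open Classical in
theorem cornerSwap_self (P : Set (Fin d → ℝ)) (i : Fin d) (x : Fin d → ℝ) :
    cornerSwap P i x i = 1 - ∑ l with Linked P i l, x l := by
  change (Pi.single i 1 : Fin d → ℝ) i + Function.update x i _ i = _
  rw [Pi.single_eq_same, Function.update_self, sub_eq_add_neg]

theorem cornerSwap_of_ne (P : Set (Fin d → ℝ)) {i k : Fin d} (hk : k ≠ i) (x : Fin d → ℝ) :
    cornerSwap P i x k = x k := by
  change (Pi.single i 1 : Fin d → ℝ) k + Function.update x i _ k = _
  rw [Pi.single_eq_of_ne hk, Function.update_of_ne hk, zero_add]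

theorem cornerSwap_cornerSwap (P : Set (Fin d → ℝ)) (i : Fin d) (x : Fin d → ℝ) :
    cornerSwap P i (cornerSwap P i x) = x := by
  classical
  ext k
  by_cases hk : k = i
  · subst hk
    have hmem : k ∈ Finset.univ.filter (Linked P k) := by simp [Linked.refl]
    rw [cornerSwap_self, ← Finset.add_sum_erase _ _ hmem, cornerSwap_self,
      ← Finset.add_sum_erase _ _ hmem,
      Finset.sum_congr rfl fun l hl => cornerSwap_of_ne P (Finset.ne_of_mem_erase hl) x]
    ring
  · rw [cornerSwap_of_ne P hk, cornerSwap_of_ne P hk]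

theorem mem_image_cornerSwap {P : Set (Fin d → ℝ)} {i : Fin d} {x : Fin d → ℝ} :
    x ∈ cornerSwap P i '' P ↔ cornerSwap P i x ∈ P :=
  ⟨by rintro ⟨y, hy, rfl⟩; rwa [cornerSwap_cornerSwap],
    fun h => ⟨_, h, cornerSwap_cornerSwap P i x⟩⟩

theorem zd_cornerSwap (P : Set (Fin d → ℝ)) (i : Fin d) (x : Fin d → ℝ) :
    Zd x ↔ Zd (cornerSwap P i x) := by
  classical
  have key : ∀ x, Zd x → Zd (cornerSwap P i x) := fun x hx k => by
    by_cases hk : k = i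
    · subst hk
      choose z hz using hx
      refine ⟨1 - ∑ l with Linked P k l, z l, ?_⟩
      rw [cornerSwap_self]
      push_cast
      simp only [hz]
    · rw [cornerSwap_of_ne P hk]
      exact hx k
  exact ⟨key x, fun h => by simpa only [cornerSwap_cornerSwap] using key _ h⟩

theorem cornerSwap_of_forall_linked {P : Set (Fin d → ℝ)} {i : Fin d} {x : Fin d → ℝ}
    (h : ∀ l, Linked P i l → x l = 0) : cornerSwap P i x = Pi.single i 1 + x := by
  classical
  ext k
  by_cases hk : k = i
  · subst hk
    rw [cornerSwap_self, Finset.sum_eq_zero fun l hl => h l (Finset.mem_filter.1 hl).2]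
    simp [h k (Linked.refl P k)]
  · rw [cornerSwap_of_ne P hk]
    simp [hk]

theorem EmptySmooth.isCornered_image_cornerSwap {P : Set (Fin d → ℝ)} (hP : EmptySmooth P)
    (hC : IsCornered P) (i : Fin d) : IsCornered (cornerSwap P i '' P) := by
  classical
  have h0 : cornerSwap P i 0 = Pi.single i 1 := by
    rw [cornerSwap_of_forall_linked (x := 0) fun _ _ => rfl, add_zero]
  refine ⟨?_, fun k => ?_, ?_⟩
  · rw [mem_image_cornerSwap, h0]
    exact hC.single_mem i
  · rw [mem_image_cornerSwap]
    by_cases hk : k = i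
    · subst hk
      rw [← h0, cornerSwap_cornerSwap]
      exact hC.zero_mem
    by_cases hlink : Linked P i k
    · have : cornerSwap P i (Pi.single k 1) = Pi.single k 1 := by
        ext l
        by_cases hl : l = i
        · subst hl
          rw [cornerSwap_self, Finset.sum_eq_single k (fun j _ hj => by simp [hj])
            (fun h => absurd hlink (by simpa using h))]
          simp [Ne.symm hk]
        · rw [cornerSwap_of_ne P hl]
      rw [this]
      exact hC.single_mem k
    · rw [cornerSwap_of_forall_linked]
      · rw [Linked, not_or, not_not] at hlink
        exact hlink.2
      · intro l hl
        exact Pi.single_eq_of_ne (by rintro rfl; exact hlink hl) _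
  · rintro _ ⟨x, hx, rfl⟩ k
    by_cases hk : k = i
    · subst hk
      rw [cornerSwap_self]
      linarith [hP.sum_linked_le_one hC k hx]
    · rw [cornerSwap_of_ne P hk]
      exact hC.nonneg x hx k

theorem EmptySmooth.sum_single_mem (S : Finset (Fin d)) : ∀ {P : Set (Fin d → ℝ)},
    EmptySmooth P → IsCornered P → (∀ i ∈ S, ∀ j ∈ S, i ≠ j → ¬ Linked P i j) →
    ∑ i ∈ S, (Pi.single i 1 : Fin d → ℝ) ∈ P := by
  induction S using Finset.induction_on with
  | empty => intro P _ hC _; simpa using hC.zero_mem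
  | insert i S hi ih =>
    intro P hP hC hS
    have hiS : ∀ k ∈ S, ¬ Linked P i k := fun k hk =>
      hS i (Finset.mem_insert_self i S) k (Finset.mem_insert_of_mem hk)
        (by rintro rfl; exact hi hk)
    have hP' := hP.image _ (zd_cornerSwap P i)
    have hC' := hP.isCornered_image_cornerSwap hC i
    have hmem := ih hP' hC' fun k hk l hl hkl hlink => by
      have h1 := hS k (Finset.mem_insert_of_mem hk) l (Finset.mem_insert_of_mem hl) hkl
      rw [Linked, not_or, not_not] at h1
      have h2 := hP'.add_le_one hC' ⟨_, h1.2, rfl⟩ (Linked.refl _ k) hlink hkl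
      have hki : k ≠ i := by rintro rfl; exact hi hk
      have hli : l ≠ i := by rintro rfl; exact hi hl
      rw [cornerSwap_of_ne P hki, cornerSwap_of_ne P hli] at h2
      simp [hkl, hkl.symm] at h2
      norm_num at h2
    rw [mem_image_cornerSwap, cornerSwap_of_forall_linked] at hmem
    · rwa [Finset.sum_insert hi]
    · intro l hl
      rw [Finset.sum_apply]
      exact Finset.sum_eq_zero fun k hk =>
        Pi.single_eq_of_ne (by rintro rfl; exact hiS _ hk hl) _

theorem Convex.sum_smul_mem_of_sum_le_one {E ι : Type*} [AddCommGroup E] [Module ℝ E] {C : Set E}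
    (hC : Convex ℝ C) (h0 : 0 ∈ C) {s : Finset ι} {w : ι → ℝ} {z : ι → E}
    (hw : ∀ i ∈ s, 0 ≤ w i) (hw1 : ∑ i ∈ s, w i ≤ 1) (hz : ∀ i ∈ s, z i ∈ C) :
    ∑ i ∈ s, w i • z i ∈ C := by
  have h := hC.sum_mem (t := Finset.insertNone s)
    (w := fun o => o.elim (1 - ∑ i ∈ s, w i) w) (z := fun o => o.elim 0 z)
    (by
      intro o ho
      cases o with
      | none => simpa using hw1
      | some i => exact hw i (by simpa using ho))
    (by simp [Finset.sum_insertNone])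
    (by
      intro o ho
      cases o with
      | none => exact h0
      | some i => exact hz i (by simpa using ho))
  simpa [Finset.sum_insertNone] using h

theorem EmptySmooth.exists_eq_product {P : Set (Fin d → ℝ)} (hP : EmptySmooth P)
    (hC : IsCornered P) : ∃ (r : ℕ) (c : Fin d → Fin r),
      P = {x : Fin d → ℝ | (∀ i, 0 ≤ x i) ∧
        ∀ j : Fin r, (∑ i ∈ Finset.univ.filter fun i => c i = j, x i) ≤ 1} := by
  classical
  let s : Setoid (Fin d) := ⟨Linked P, Linked.refl P, Linked.symm, hP.linked_trans hC⟩
  let e := Fintype.equivFin (Quotient s)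
  let c : Fin d → Fin (Fintype.card (Quotient s)) := fun i => e (Quotient.mk s i)
  have hc : ∀ i j, c i = c j ↔ Linked P i j := fun i j =>
    e.apply_eq_iff_eq.trans Quotient.eq
  have hsurj : ∀ j, ∃ i, c i = j := fun j => by
    obtain ⟨i, hi⟩ := Quotient.exists_rep (e.symm j)
    exact ⟨i, ((e.symm_apply_eq).1 hi.symm).symm⟩
  refine ⟨_, c, Set.Subset.antisymm (fun x hx => ⟨hC.nonneg x hx, fun j => ?_⟩) ?_⟩
  · obtain ⟨i, rfl⟩ := hsurj j
    simpa only [eq_comm (b := c i), hc] using hP.sum_linked_le_one hC i hx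
  · rintro y ⟨hy0, hy1⟩
    let t : Fin (Fintype.card (Quotient s)) → Set (Fin d → ℝ) := fun j =>
      insert 0 ((fun i => Pi.single i 1) '' {i | c i = j})
    let z : Fin (Fintype.card (Quotient s)) → Fin d → ℝ := fun j =>
      ∑ i with c i = j, y i • Pi.single i 1
    have hz : z ∈ convexHull ℝ (Set.univ.pi t) := by
      rw [convexHull_pi]
      intro j _
      refine (convex_convexHull ℝ _).sum_smul_mem_of_sum_le_one
        (subset_convexHull ℝ _ (Set.mem_insert _ _)) (fun i _ => hy0 i) (hy1 j) fun i hi => ?_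
      exact subset_convexHull ℝ _ (Or.inr ⟨i, (Finset.mem_filter.1 hi).2, rfl⟩)
    let L : (Fin (Fintype.card (Quotient s)) → Fin d → ℝ) →ₗ[ℝ] (Fin d → ℝ) :=
      ∑ j, LinearMap.proj j
    have hL : ∀ u, L u = ∑ j, u j := fun u => by simp [L]
    have hyL : L z = y := by
      rw [hL, Finset.sum_fiberwise]
      ext k
      simp [Finset.sum_apply, Pi.single_apply]
    have hyP : L z ∈ convexHull ℝ (L '' Set.univ.pi t) := by
      rw [← L.image_convexHull]
      exact ⟨z, hz, rfl⟩
    rw [hyL] at hyP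
    refine convexHull_min ?_ hP.convex hyP
    rintro _ ⟨u, hu, rfl⟩
    have hu' : ∀ j, ∃ i, c i = j ∧ (u j ≠ 0 → Pi.single i 1 = u j) := fun j => by
      rcases hu j trivial with h | ⟨i, hi, h⟩
      · exact (hsurj j).imp fun i hi => ⟨hi, fun h0 => absurd h h0⟩
      · exact ⟨i, hi, fun _ => h⟩
    choose g hgc hg using hu'
    have hsum : L u = ∑ i ∈ (Finset.univ.filter fun j => u j ≠ 0).image g, Pi.single i 1 := by
      rw [Finset.sum_image, hL, ← Finset.sum_filter_ne_zero]
      · exact Finset.sum_congr rfl fun j hj => (hg j (Finset.mem_filter.1 hj).2).symm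
      · exact (Function.LeftInverse.injective hgc).injOn
    rw [hsum]
    refine sum_single_mem _ hP hC ?_
    intro a ha b hb hab hlink
    obtain ⟨j, -, rfl⟩ := Finset.mem_image.1 ha
    obtain ⟨k, -, rfl⟩ := Finset.mem_image.1 hb
    rw [← hc, hgc, hgc] at hlink
    exact hab (congrArg g hlink)

theorem Zd.vecMul_map {x : Fin d → ℝ} (hx : Zd x) (A : Matrix (Fin d) (Fin d) ℤ) :
    Zd (Matrix.vecMul x (A.map (Int.cast : ℤ → ℝ))) := fun k => by
  choose z hz using hx
  exact ⟨∑ l, z l * A l k, by simp [Matrix.vecMul, dotProduct, hz]⟩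

theorem emptySmooth_of_isSmooth {P : Set (Fin d → ℝ)} (hP : IsLatticePolytope Zd P)
    (hsmooth : IsSmooth P) (hempty : ∀ x ∈ P, Zd x → IsVertexOf P x) : EmptySmooth P := by
  obtain ⟨V, -, hVZ, hPV⟩ := hP
  have hVP : ∀ u ∈ V, u ∈ P := fun u hu => by rw [hPV]; exact subset_convexHull ℝ _ hu
  have hconv : Convex ℝ P := by rw [hPV]; exact convex_convexHull ℝ _
  refine ⟨hconv, fun x hx hz => (hempty x hx hz).mem_extremePoints, fun v hv hz => ?_⟩
  obtain ⟨w, hw, hedge, m, hm, hdet⟩ := hsmooth v (hempty v hv hz)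
  have hunit : IsUnit (Matrix.of m).det := by
    rcases hdet with h | h <;> (erw [h]; simp)
  let A : Matrix (Fin d) (Fin d) ℝ := (Matrix.of m).map (Int.cast : ℤ → ℝ)
  let B : Matrix (Fin d) (Fin d) ℝ := ((Matrix.of m)⁻¹).map (Int.cast : ℤ → ℝ)
  have hAB : A * B = 1 := by
    have := congrArg (Matrix.map · (Int.castRingHom ℝ)) (Matrix.mul_nonsing_inv (Matrix.of m) hunit)
    simp only [Matrix.map_mul, map_zero, map_one, Matrix.map_one] at this
    exact this
  have hBA : B * A = 1 := mul_eq_one_comm.1 hAB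
  let N := Matrix.toLinearEquivRight'OfInv hAB hBA
  have hNapply : ∀ x, N x = Matrix.vecMul x B := fun x => rfl
  have hNsymm : ∀ x, N.symm x = Matrix.vecMul x A := fun x => rfl
  have hNrow : ∀ k, N.symm (Pi.single k 1) = fun j => (m k j : ℝ) := fun k => by
    rw [hNsymm]; ext j; simp [A]
  have hrow : ∀ i, w i = v + N.symm (Pi.single i 1) := by
    intro i
    obtain ⟨k, hk, hwk⟩ := hm i
    have hwk' : w i - v = (k : ℝ) • N.symm (Pi.single i 1) := by rw [hwk, hNrow]; rfl
    have hwP := (hw i).1.mem_extremePoints.1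
    suffices hk1 : k = 1 by
      rw [hk1] at hwk'
      rw [← sub_eq_iff_eq_add', hwk', Nat.cast_one, one_smul]
    by_contra hne
    have hk1 : (1 : ℝ) < k := by exact_mod_cast (by omega : 1 < k)
    have hk0 : (0 : ℝ) < k := by linarith
    have hpt : v + (k : ℝ)⁻¹ • (w i - v) = v + N.symm (Pi.single i 1) := by
      rw [hwk', inv_smul_smul₀ hk0.ne']
    have hmem : v + (k : ℝ)⁻¹ • (w i - v) ∈ P := hconv.add_smul_sub_mem hv hwP
      ⟨(inv_pos.2 hk0).le, (inv_lt_one_of_one_lt₀ hk1).le⟩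
    have hzd : Zd (v + (k : ℝ)⁻¹ • (w i - v)) := by
      rw [hpt, hNsymm]
      exact hz.add ((zd_single i).vecMul_map _)
    exact (hw i).2.1 (eq_of_mem_extremePoints hv hwP (inv_pos.2 hk0)
      (inv_lt_one_of_one_lt₀ hk1) (hempty _ hmem hzd).mem_extremePoints)
  refine ⟨N, fun x => ⟨fun hx => hx.vecMul_map _, fun hx => ?_⟩, fun x hx k => ?_, fun k => ?_⟩
  · rw [← N.symm_apply_apply x]
    exact Zd.vecMul_map hx _
  · have hvV : v ∈ V := by
      have := (hempty v hv hz).mem_extremePoints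
      rw [hPV] at this
      exact extremePoints_convexHull_subset this
    have := le_of_forall_isEdgeOf_le hPV (fun u hu => hempty u (hVP u hu) (hVZ u hu)) hvV
      (LinearMap.proj k ∘ₗ N.toLinearMap) (fun u hu hvu => by
        obtain ⟨i, rfl⟩ := hedge u hu hvu
        rw [hrow i]
        simp only [LinearMap.comp_apply, LinearEquiv.coe_coe, map_add, N.apply_symm_apply,
          LinearMap.proj_apply, le_add_iff_nonneg_right]
        exact (Pi.single_nonneg.2 zero_le_one : (0 : Fin d → ℝ) ≤ Pi.single i 1) k) x hx
    rw [map_sub]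
    exact sub_nonneg.2 this
  · rw [← hrow k]
    exact (hw k).1.mem_extremePoints.1

end Lattice

/-- **Empty smooth polytopes.** Every smooth lattice polytope whose only lattice points
are its vertices is lattice equivalent to a product of unimodular simplices (realized as
`{x : 0 ≤ x, ∑_{i ∈ class} xᵢ ≤ 1}` for a partition of the coordinates). -/
theorem smooth_empty_polytope_is_product_of_simplices {d : ℕ}
    (P : Set (Fin d → ℝ)) (hP : IsLatticePolytope Zd P)
    (hfull : affineSpan ℝ P = ⊤) (hsmooth : IsSmooth P)
    (hempty : ∀ x ∈ P, Zd x → IsVertexOf P x) :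
    ∃ f : (Fin d → ℝ) ≃ᵃ[ℝ] (Fin d → ℝ),
      (∀ x, Zd x ↔ Zd (f x)) ∧
      ∃ (r : ℕ) (c : Fin d → Fin r),
        f '' P = {x : Fin d → ℝ | (∀ i, 0 ≤ x i) ∧
          ∀ j : Fin r, (∑ i ∈ Finset.univ.filter fun i => c i = j, x i) ≤ 1} := by
  have hE := emptySmooth_of_isSmooth hP hsmooth hempty
  obtain ⟨V, ⟨v, hvV⟩, hVZ, hPV⟩ := hP
  have hv : v ∈ P := by rw [hPV]; exact subset_convexHull ℝ _ hvV
  have hz := hVZ v hvV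
  obtain ⟨N, hN, hpos, hmem⟩ := hE.chart v hv hz
  let f : (Fin d → ℝ) ≃ᵃ[ℝ] (Fin d → ℝ) :=
    (AffineEquiv.constVAdd ℝ (Fin d → ℝ) (-v)).trans N.toAffineEquiv
  have hf : ∀ x, f x = N (x - v) := fun x => by
    simp [f, sub_eq_neg_add]
  have hfZ : ∀ x, Zd x ↔ Zd (f x) := fun x => by
    rw [hf, ← hN, Zd.sub_iff hz]
  have hC : IsCornered (f '' P) := by
    refine ⟨⟨v, hv, by simp [hf]⟩, fun i => ⟨_, hmem i, by simp [hf]⟩, ?_⟩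
    rintro _ ⟨x, hx, rfl⟩ i
    rw [hf]
    exact hpos x hx i
  exact ⟨f, hfZ, (hE.image f hfZ).exists_eq_product hC⟩
end

section
/- Let P be a lattice polytope and c a positive integer. If P has a unimodular triangulation, then the dilation cP has a unimodular triangulation; moreover, if the triangulation of P is regular, then cP has a regular unimodular triangulation, and if the triangulation of P is quadratic (regular, unimodular and flag), then cP also has a quadratic triangulation. -/
theorem exists_maxCell_superset {E : Type*} {T : Finset (Finset E)} {F : Finset E} (hF : F ∈ T) :
    ∃ G, MaxCell T G ∧ F ⊆ G := by
  obtain ⟨G, hFG, hG⟩ := T.exists_le_maximal hF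
  exact ⟨G, ⟨hG.1, fun H hH hGH => Finset.Subset.antisymm (hG.2 hH hGH) hGH⟩, hFG⟩

theorem exists_enumeration {E : Type*} [Nonempty E] (V : Finset E) :
    ∃ (e : ℕ → E) (rank : E → ℕ), (∀ i < V.card, e i ∈ V ∧ rank (e i) = i) ∧
      ∀ x ∈ V, rank x < V.card ∧ e (rank x) = x := by
  classical
  let f := V.equivFin
  refine ⟨fun i => if h : i < V.card then f.symm ⟨i, h⟩ else Classical.arbitrary E,
    fun x => if h : x ∈ V then f ⟨x, h⟩ else 0, fun i hi => ?_, fun x hx => ?_⟩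
  · simp [hi]
  · simp [hx]

section Weights

variable {E : Type*} [AddCommGroup E] [Module ℝ E]

theorem exists_weights_of_mem_convexHull {F : Finset E} {x : E}
    (hx : x ∈ convexHull ℝ (F : Set E)) :
    ∃ w : E → ℝ, (∀ y, 0 ≤ w y) ∧ (∀ y, y ∉ F → w y = 0) ∧ ∑ y ∈ F, w y = 1 ∧
      ∑ y ∈ F, w y • y = x := by
  classical
  obtain ⟨w, h0, h1, h2⟩ := Finset.mem_convexHull'.1 hx
  refine ⟨fun y => if y ∈ F then w y else 0, fun y => ?_, fun y hy => by simp [hy], ?_, ?_⟩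
  · by_cases hy : y ∈ F <;> simp [hy, h0]
  · rw [← h1]
    exact Finset.sum_congr rfl fun y hy => by simp [hy]
  · rw [← h2]
    exact Finset.sum_congr rfl fun y hy => by simp [hy]

theorem affineIndependent_coe_iff {F : Finset E} :
    AffineIndependent ℝ (fun p : F => (p : E)) ↔
      ∀ w : E → ℝ, ∑ y ∈ F, w y = 0 → ∑ y ∈ F, w y • y = 0 → ∀ y ∈ F, w y = 0 := by
  classical
  rw [affineIndependent_iff]
  constructor
  · intro h w h0 h1 y hy
    refine h Finset.univ (fun p => w p) ?_ ?_ ⟨y, hy⟩ (Finset.mem_univ _)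
    · rw [← h0]; exact Finset.sum_coe_sort F w
    · rw [← h1]; exact Finset.sum_coe_sort F (fun y => w y • y)
  · intro h s w h0 h1 e he
    let w' : E → ℝ := fun y =>
      if hy : y ∈ F then (if (⟨y, hy⟩ : F) ∈ s then w ⟨y, hy⟩ else 0) else 0
    have hw' : ∀ p : F, w' p = if p ∈ s then w p else 0 := fun p => by simp [w']
    have := h w' ?_ ?_ e e.2
    · simpa [hw', he] using this
    · rw [← Finset.sum_coe_sort F w']
      simp only [hw']
      rw [Finset.sum_ite_mem, Finset.univ_inter]
      exact h0
    · rw [← Finset.sum_coe_sort F (fun y => w' y • y)]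
      simp only [hw', ite_smul, zero_smul]
      rw [Finset.sum_ite_mem, Finset.univ_inter]
      exact h1

theorem weights_unique {F : Finset E} (hF : AffineIndependent ℝ (fun p : F => (p : E)))
    {u w : E → ℝ} (hs : ∑ y ∈ F, u y = ∑ y ∈ F, w y)
    (hp : ∑ y ∈ F, u y • y = ∑ y ∈ F, w y • y) : ∀ y ∈ F, u y = w y := by
  intro y hy
  have := affineIndependent_coe_iff.1 hF (fun y => u y - w y)
    (by simp [Finset.sum_sub_distrib, hs]) (by simp [sub_smul, Finset.sum_sub_distrib, hp]) y hy
  linarith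

theorem exists_weights_of_mem_affineSpan {F : Finset E} {x : E}
    (hx : x ∈ affineSpan ℝ (F : Set E)) :
    ∃ w : E → ℝ, (∀ y, y ∉ F → w y = 0) ∧ ∑ y ∈ F, w y = 1 ∧ ∑ y ∈ F, w y • y = x := by
  classical
  have hr : (F : Set E) = Set.range (fun p : F => (p : E)) := by simp
  rw [hr] at hx
  obtain ⟨w, h1, h2⟩ := eq_affineCombination_of_mem_affineSpan_of_fintype hx
  rw [Finset.affineCombination_eq_linear_combination _ _ _ h1] at h2
  let w' : E → ℝ := fun y => if hy : y ∈ F then w ⟨y, hy⟩ else 0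
  have hw' : ∀ p : F, w' p = w p := fun p => by simp [w']
  refine ⟨w', fun y hy => by simp [w', hy], ?_, ?_⟩
  · rw [← Finset.sum_coe_sort F w', ← h1]
    simp [hw']
  · rw [← Finset.sum_coe_sort F (fun y => w' y • y), h2]
    simp [hw']

theorem sum_smul_mem_affineSpan {F : Finset E} {w : E → ℝ} (h1 : ∑ y ∈ F, w y = 1) :
    ∑ y ∈ F, w y • y ∈ affineSpan ℝ (F : Set E) := by
  classical
  have h1' : ∑ p : F, w p = 1 := by rw [← h1]; exact Finset.sum_coe_sort F w
  have := affineCombination_mem_affineSpan (k := ℝ) (s := Finset.univ) (w := fun p : F => w p) h1'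
    (fun p : F => (p : E))
  rw [Finset.affineCombination_eq_linear_combination _ _ _ h1'] at this
  rw [← Finset.sum_coe_sort F (fun y => w y • y)]
  simpa using this

theorem AffineMap.apply_sum_smul (g : E →ᵃ[ℝ] ℝ) {ι : Type*} (F : Finset ι) (w : ι → ℝ)
    (p : ι → E) (h1 : ∑ y ∈ F, w y = 1) : g (∑ y ∈ F, w y • p y) = ∑ y ∈ F, w y * g (p y) := by
  rw [← Finset.affineCombination_eq_linear_combination _ _ _ h1,
    Finset.map_affineCombination _ _ _ h1, Finset.affineCombination_eq_linear_combination _ _ _ h1]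
  simp

theorem exists_affineMap_eq [FiniteDimensional ℝ E] {F : Finset E}
    (hF : AffineIndependent ℝ (fun p : F => (p : E))) (φ : E → ℝ) :
    ∃ g : E →ᵃ[ℝ] ℝ, ∀ x ∈ F, g x = φ x := by
  classical
  have hF' : AffineIndependent ℝ (fun p : (F : Set E) => (p : E)) := hF
  obtain ⟨t, hst, hind, htop⟩ := exists_subset_affineIndependent_affineSpan_eq_top hF'
  let b : AffineBasis t ℝ E := ⟨fun p => p, hind, by simpa using htop⟩
  have : Finite t := b.finite
  have := Fintype.ofFinite t
  refine ⟨∑ i : t, φ i • b.coord i, fun x hx => ?_⟩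
  have hsum : ∀ s : Finset t, (∑ i ∈ s, φ i • b.coord i) x = ∑ i ∈ s, φ i * b.coord i x := by
    intro s
    induction s using Finset.induction_on with
    | empty => simp
    | insert a s ha ih => simp [Finset.sum_insert ha, ih]
  rw [hsum]
  have hbx : ∀ i : t, b.coord i x = if i = ⟨x, hst hx⟩ then 1 else 0 := fun i => by
    have := b.coord_apply i ⟨x, hst hx⟩
    exact this
  simp [hbx]

end Weights

section Triangulation

variable {E : Type*} [AddCommGroup E] [Module ℝ E] {P : Set E} {T : Finset (Finset E)}

theorem sum_smul_mem_convexHull {F : Finset E} {w : E → ℝ} (h0 : ∀ y, 0 ≤ w y)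
    (h1 : ∑ y ∈ F, w y = 1) : ∑ y ∈ F, w y • y ∈ convexHull ℝ (F : Set E) :=
  Finset.mem_convexHull'.2 ⟨w, fun y _ => h0 y, h1, rfl⟩

theorem isTriangulation_of_weights_unique
    (hdown : ∀ F ∈ T, ∀ G, G ⊆ F → G ∈ T)
    (hsub : ∀ F ∈ T, convexHull ℝ (F : Set E) ⊆ P)
    (hcov : ∀ x ∈ P, ∃ F ∈ T, x ∈ convexHull ℝ (F : Set E))
    (huniq : ∀ F ∈ T, ∀ G ∈ T, ∀ u w : E → ℝ, (∀ y, 0 ≤ u y) → (∀ y, 0 ≤ w y) →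
      (∀ y, y ∉ F → u y = 0) → (∀ y, y ∉ G → w y = 0) →
      ∑ y ∈ F, u y = 1 → ∑ y ∈ G, w y = 1 →
      ∑ y ∈ F, u y • y = ∑ y ∈ G, w y • y → u = w) :
    IsTriangulation P T := by
  classical
  refine ⟨fun F hF => ?_, hdown, fun F hF G hG => ?_, ?_⟩
  · rw [affineIndependent_coe_iff]
    intro w h0 h1
    let p : E → ℝ := fun y => if y ∈ F then max (w y) 0 else 0
    let q : E → ℝ := fun y => if y ∈ F then max (-w y) 0 else 0
    have hpq : ∀ y ∈ F, w y = p y - q y := fun y hy => by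
      simp only [p, q, hy, if_true]
      rcases le_total (w y) 0 with h | h
      · rw [max_eq_right h, max_eq_left (by linarith)]; ring
      · rw [max_eq_left h, max_eq_right (by linarith)]; ring
    have hp0 : ∀ y, 0 ≤ p y := fun y => by by_cases hy : y ∈ F <;> simp [p, hy]
    have hq0 : ∀ y, 0 ≤ q y := fun y => by by_cases hy : y ∈ F <;> simp [q, hy]
    have hsum : ∑ y ∈ F, p y = ∑ y ∈ F, q y := by
      rw [Finset.sum_congr rfl hpq, Finset.sum_sub_distrib] at h0
      linarith
    have hpt : ∑ y ∈ F, p y • y = ∑ y ∈ F, q y • y := by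
      rw [Finset.sum_congr rfl fun y hy => by rw [hpq y hy, sub_smul],
        Finset.sum_sub_distrib] at h1
      exact sub_eq_zero.1 h1
    by_cases hs : ∑ y ∈ F, p y = 0
    · intro y hy
      rw [hpq y hy, (Finset.sum_eq_zero_iff_of_nonneg fun y _ => hp0 y).1 hs y hy,
        (Finset.sum_eq_zero_iff_of_nonneg fun y _ => hq0 y).1 (hsum ▸ hs) y hy, sub_zero]
    · have hs0 : 0 ≤ (∑ y ∈ F, p y)⁻¹ := inv_nonneg.2 (Finset.sum_nonneg fun y _ => hp0 y)
      have key := huniq F hF F hF (fun y => (∑ y ∈ F, p y)⁻¹ * p y)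
        (fun y => (∑ y ∈ F, p y)⁻¹ * q y) (fun y => mul_nonneg hs0 (hp0 y))
        (fun y => mul_nonneg hs0 (hq0 y)) (fun y hy => by simp [p, hy])
        (fun y hy => by simp [q, hy]) (by rw [← Finset.mul_sum, inv_mul_cancel₀ hs])
        (by rw [← Finset.mul_sum, ← hsum, inv_mul_cancel₀ hs])
        (by simp only [mul_smul, ← Finset.smul_sum, hpt])
      intro y hy
      have := mul_left_cancel₀ (inv_ne_zero hs) (congrFun key y)
      rw [hpq y hy, this, sub_self]
  · refine Set.Subset.antisymm ?_ (Set.subset_inter (convexHull_mono Set.inter_subset_left)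
      (convexHull_mono Set.inter_subset_right))
    rintro x ⟨hx, hx'⟩
    obtain ⟨u, u0, uF, u1, rfl⟩ := exists_weights_of_mem_convexHull hx
    obtain ⟨w, w0, wG, w1, hw⟩ := exists_weights_of_mem_convexHull hx'
    have huw := huniq F hF G hG u w u0 w0 uF wG u1 w1 hw.symm
    have hz : ∀ y ∈ F, y ∉ F ∩ G → u y = 0 := fun y hy hy' => by
      rw [huw]
      exact wG y fun h => hy' (Finset.mem_inter.2 ⟨hy, h⟩)
    rw [← Finset.coe_inter, ← Finset.sum_subset Finset.inter_subset_left
      fun y hy hy' => by rw [hz y hy hy', zero_smul]]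
    exact sum_smul_mem_convexHull u0
      (by rw [← u1]; exact Finset.sum_subset Finset.inter_subset_left hz)
  · ext x
    simp only [Set.mem_iUnion, exists_prop]
    exact ⟨fun ⟨F, hF, hx⟩ => hsub F hF hx, hcov x⟩

namespace IsTriangulation

theorem affineIndependent (hT : IsTriangulation P T) {F : Finset E} (hF : F ∈ T) :
    AffineIndependent ℝ (fun p : F => (p : E)) := hT.1 F hF

theorem convexHull_subset (hT : IsTriangulation P T) {F : Finset E} (hF : F ∈ T) :
    convexHull ℝ (F : Set E) ⊆ P := by
  rw [← hT.2.2.2]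
  exact Set.subset_biUnion_of_mem (u := fun F : Finset E => convexHull ℝ (F : Set E)) hF

theorem exists_face (hT : IsTriangulation P T) {x : E} (hx : x ∈ P) :
    ∃ F ∈ T, x ∈ convexHull ℝ (F : Set E) := by
  rw [← hT.2.2.2] at hx
  simpa only [Set.mem_iUnion, exists_prop] using hx

theorem singleton_mem (hT : IsTriangulation P T) {F : Finset E} (hF : F ∈ T) {x : E}
    (hx : x ∈ F) : {x} ∈ T :=
  hT.2.1 F hF _ (by simpa using hx)

theorem support_subset (hT : IsTriangulation P T) {F G : Finset E} (hF : F ∈ T) (hG : G ∈ T)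
    {u : E → ℝ}
    (u0 : ∀ y, 0 ≤ u y) (u1 : ∑ y ∈ F, u y = 1)
    (hu : ∑ y ∈ F, u y • y ∈ convexHull ℝ (G : Set E)) :
    ∀ y ∈ F, u y ≠ 0 → y ∈ G := by
  classical
  have h : ∑ y ∈ F, u y • y ∈ convexHull ℝ (F : Set E) ∩ convexHull ℝ (G : Set E) :=
    ⟨sum_smul_mem_convexHull u0 u1, hu⟩
  rw [hT.2.2.1 F hF G hG, ← Finset.coe_inter] at h
  obtain ⟨w, -, w0, w1, hw⟩ := exists_weights_of_mem_convexHull h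
  intro y hy hne
  by_contra hyG
  refine hne ?_
  rw [weights_unique (hT.affineIndependent hF) (u := u) (w := w) ?_ ?_ y hy]
  · exact w0 y fun h => hyG (Finset.mem_inter.1 h).2
  · rw [u1, ← w1]
    exact Finset.sum_subset Finset.inter_subset_left fun y _ hy => w0 y hy
  · rw [← hw]
    exact Finset.sum_subset Finset.inter_subset_left fun y _ hy => by rw [w0 y hy, zero_smul]

theorem weights_ext (hT : IsTriangulation P T) {F G : Finset E} (hF : F ∈ T) (hG : G ∈ T)
    {u w : E → ℝ}
    (u0 : ∀ y, 0 ≤ u y) (w0 : ∀ y, 0 ≤ w y) (uF : ∀ y, y ∉ F → u y = 0)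
    (wG : ∀ y, y ∉ G → w y = 0) (u1 : ∑ y ∈ F, u y = 1) (w1 : ∑ y ∈ G, w y = 1)
    (h : ∑ y ∈ F, u y • y = ∑ y ∈ G, w y • y) : u = w := by
  have hu : ∀ y, u y ≠ 0 → y ∈ F ∧ y ∈ G := fun y hy => by
    have hyF : y ∈ F := by_contra fun h => hy (uF y h)
    exact ⟨hyF, hT.support_subset hF hG u0 u1 (h ▸ sum_smul_mem_convexHull w0 w1) y hyF hy⟩
  have hw : ∀ y, w y ≠ 0 → y ∈ F ∧ y ∈ G := fun y hy => by
    have hyG : y ∈ G := by_contra fun h => hy (wG y h)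
    exact ⟨hT.support_subset hG hF w0 w1 (h ▸ sum_smul_mem_convexHull u0 u1) y hyG hy, hyG⟩
  classical
  have hwF : ∀ y ∈ G, y ∉ F ∩ G → w y = 0 := fun y _ hy =>
    by_contra fun h => hy (Finset.mem_inter.2 (hw y h))
  have hwF' : ∀ y ∈ F, y ∉ F ∩ G → w y = 0 := fun y _ hy =>
    by_contra fun h => hy (Finset.mem_inter.2 (hw y h))
  have key := weights_unique (hT.affineIndependent hF) (u := u) (w := w)
    (by
      rw [u1, ← w1, ← Finset.sum_subset Finset.inter_subset_left hwF',
        ← Finset.sum_subset Finset.inter_subset_right hwF])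
    (by
      rw [h]
      exact (Finset.sum_subset Finset.inter_subset_right
          fun y h1 h2 => by rw [hwF y h1 h2, zero_smul]).symm.trans
        (Finset.sum_subset Finset.inter_subset_left
          fun y h1 h2 => by rw [hwF' y h1 h2, zero_smul]))
  funext y
  by_cases hy : y ∈ F
  · exact key y hy
  · rw [uF y hy]
    exact (by_contra fun h => hy (hw y (Ne.symm h)).1)

theorem exists_maxCell_of_mem (hT : IsTriangulation P T) {x : E} (hx : x ∈ P) :
    ∃ F, MaxCell T F ∧ x ∈ convexHull ℝ (F : Set E) := by
  obtain ⟨F, hF, hxF⟩ := hT.exists_face hx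
  obtain ⟨G, hG, hFG⟩ := exists_maxCell_superset hF
  exact ⟨G, hG, convexHull_mono (by exact_mod_cast hFG) hxF⟩

theorem maxCell_nonempty (hT : IsTriangulation P T) (hP : P.Nonempty) {F : Finset E}
    (hF : MaxCell T F) : F.Nonempty := by
  obtain ⟨x, hx⟩ := hP
  obtain ⟨G, hG, hxG⟩ := hT.exists_face hx
  rw [Finset.nonempty_iff_ne_empty]
  rintro rfl
  rw [hF.2 G hG (Finset.empty_subset _)] at hxG
  simp at hxG

end IsTriangulation

end Triangulation

section Regular

open Filter Topology

variable {E : Type*} [NormedAddCommGroup E] [NormedSpace ℝ E] {P : Set E} {T : Finset (Finset E)}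

namespace IsTriangulation

/-- A curve which stays in `P` for small positive times visits some maximal cell at arbitrarily
small positive times. -/
theorem exists_maxCell_frequently (hT : IsTriangulation P T) {p : ℝ → E} (hp : Continuous p)
    (hpP : ∀ᶠ t in 𝓝[>] (0 : ℝ), p t ∈ P) :
    ∃ G, MaxCell T G ∧ p 0 ∈ convexHull ℝ (G : Set E) ∧
      ∃ᶠ t in 𝓝[>] (0 : ℝ), p t ∈ convexHull ℝ (G : Set E) := by
  obtain ⟨G, hGT, hG⟩ : ∃ G ∈ T, ∃ᶠ t in 𝓝[>] (0 : ℝ),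
      MaxCell T G ∧ p t ∈ convexHull ℝ (G : Set E) := by
    by_contra! H
    have H' := (Filter.eventually_all_finset T).2 fun G hG => H G hG
    obtain ⟨t, h1, h2⟩ := (H'.and hpP).exists
    obtain ⟨G, hG, hx⟩ := hT.exists_maxCell_of_mem h2
    exact h1 G hG.1 hG hx
  refine ⟨G, hG.exists.choose_spec.1, ?_, hG.mono fun t h => h.2⟩
  have hcl : IsClosed (convexHull ℝ (G : Set E)) :=
    (G.finite_toSet.isCompact_convexHull ℝ).isClosed
  exact hcl.mem_of_frequently_of_tendsto (hG.mono fun t h => h.2)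
    (hp.continuousAt.tendsto.mono_left nhdsWithin_le_nhds)

theorem subset_affineSpan (hT : IsTriangulation P T) (hP : Convex ℝ P) {F : Finset E}
    (hF : MaxCell T F) :
    P ⊆ affineSpan ℝ (F : Set E) := by
  intro x hx
  have hne := hT.maxCell_nonempty ⟨x, hx⟩ hF
  have hcard : (F.card : ℝ) ≠ 0 := by simpa using hne.ne_empty
  have u1 : ∑ y ∈ F, (F.card : ℝ)⁻¹ = 1 := by simp [hcard]
  have u0 : ∀ y : E, 0 ≤ (fun _ => (F.card : ℝ)⁻¹) y := fun _ => by positivity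
  have hzF := sum_smul_mem_convexHull u0 u1
  set z := ∑ y ∈ F, (F.card : ℝ)⁻¹ • y with hz
  have hzP := hT.convexHull_subset hF.1 hzF
  obtain ⟨G, hG, h0, hfr⟩ := hT.exists_maxCell_frequently (p := fun t => AffineMap.lineMap z x t)
    (AffineMap.lineMap_continuous) (by
      have : ∀ᶠ t in 𝓝[>] (0 : ℝ), t ∈ Set.Ioo (0 : ℝ) 1 := Ioo_mem_nhdsGT one_pos
      filter_upwards [this] with t ht
      exact hP.lineMap_mem hzP hx ⟨ht.1.le, ht.2.le⟩)
  rw [AffineMap.lineMap_apply_zero] at h0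
  have hFG : F ⊆ G := fun y hy =>
    hT.support_subset hF.1 hG.1 u0 u1 h0 y hy (inv_ne_zero hcard)
  obtain rfl := hF.2 G hG.1 hFG
  obtain ⟨t, h1, h2⟩ := (hfr.and_eventually self_mem_nhdsWithin).exists
  have ht : (t : ℝ) ≠ 0 := ne_of_gt h2
  have := AffineMap.lineMap_mem (t⁻¹) (convexHull_subset_affineSpan _ hzF)
    (convexHull_subset_affineSpan _ h1)
  convert this using 1
  simp [AffineMap.lineMap_apply, smul_smul, ht]

end IsTriangulation

end Regular

section Regular

open Filter Topology

variable {E : Type*} [NormedAddCommGroup E] [NormedSpace ℝ E] {P : Set E} {T : Finset (Finset E)}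

theorem eventually_nhdsGT_eval_ne_zero {p : Polynomial ℝ} (hp : p ≠ 0) :
    ∀ᶠ t in 𝓝[>] (0 : ℝ), p.eval t ≠ 0 := by
  have h : ∀ᶠ t in 𝓝[>] (0 : ℝ), ∀ r ∈ p.roots.toFinset, t ≠ r := by
    rw [Filter.eventually_all_finset]
    intro r _
    rcases le_or_gt r 0 with hr | hr
    · filter_upwards [self_mem_nhdsWithin] with t ht
      exact ne_of_gt (lt_of_le_of_lt hr ht)
    · filter_upwards [Ioo_mem_nhdsGT hr] with t ht
      exact ne_of_lt ht.2
  filter_upwards [h] with t ht h0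
  exact ht t (by simpa [hp] using h0) rfl

namespace IsTriangulation

theorem affine_le_of_convexOn (hT : IsTriangulation P T) {f : E → ℝ} (hf : ConvexOn ℝ P f)
    {F : Finset E}
    (hF : MaxCell T F) {g : E →ᵃ[ℝ] ℝ} (hg : Set.EqOn f g (convexHull ℝ (F : Set E))) :
    ∀ x ∈ P, g x ≤ f x := by
  intro x hx
  have hne := hT.maxCell_nonempty ⟨x, hx⟩ hF
  have hcard : (F.card : ℝ) ≠ 0 := by simpa using hne.ne_empty
  obtain ⟨u, -, u1, hux⟩ := exists_weights_of_mem_affineSpan (hT.subset_affineSpan hf.1 hF hx)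
  set n : ℝ := (F.card : ℝ)⁻¹ with hn
  have hn0 : 0 < n := by have := hne.card_pos; positivity
  have hn1 : ∑ y ∈ F, n = 1 := by simp [n, hcard]
  obtain ⟨ε, hε, hε0⟩ : ∃ ε : ℝ, (∀ y ∈ F, 0 < n + ε * (n - u y)) ∧ 0 < ε := by
    have h : ∀ᶠ ε in 𝓝[>] (0 : ℝ), ∀ y ∈ F, 0 < n + ε * (n - u y) := by
      rw [Filter.eventually_all_finset]
      intro y _
      have hc : Continuous fun ε : ℝ => n + ε * (n - u y) := by fun_prop
      exact (hc.continuousAt.eventually (lt_mem_nhds (by simpa using hn0))).filter_mono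
        nhdsWithin_le_nhds
    exact (h.and self_mem_nhdsWithin).exists
  have hz : ∑ y ∈ F, n • y ∈ convexHull ℝ (F : Set E) :=
    sum_smul_mem_convexHull (fun _ => hn0.le) hn1
  have hz' : ∑ y ∈ F, (n + ε * (n - u y)) • y ∈ convexHull ℝ (F : Set E) :=
    Finset.mem_convexHull'.2 ⟨_, fun y hy => (hε y hy).le, by
      rw [Finset.sum_add_distrib, ← Finset.mul_sum, Finset.sum_sub_distrib, hn1, u1]; ring, rfl⟩
  set z := ∑ y ∈ F, n • y
  have hzz : ∑ y ∈ F, (n + ε * (n - u y)) • y = z + ε • (z - x) := by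
    simp only [z, ← hux, add_smul, mul_smul, sub_smul, Finset.sum_add_distrib, ← Finset.smul_sum,
      Finset.sum_sub_distrib]
  rw [hzz] at hz'
  set z' := z + ε • (z - x) with hz'def
  have hpos : (1 + ε) ≠ 0 := by positivity
  have hcomb : (1 / (1 + ε)) • z' + (ε / (1 + ε)) • x = z := by
    rw [hz'def]
    match_scalars <;> field_simp
    ring
  have hab : 1 / (1 + ε) + ε / (1 + ε) = 1 := by field_simp
  have h1 := hf.2 (hT.convexHull_subset hF.1 hz') hx
    (show 0 ≤ 1 / (1 + ε) by positivity) (show 0 ≤ ε / (1 + ε) by positivity) hab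
  have h2 := Convex.combo_affine_apply (f := g) (x := z') (y := x) hab
  rw [hcomb, hg hz, hg hz'] at h1
  rw [hcomb] at h2
  rw [h2] at h1
  simp only [smul_eq_mul, add_le_add_iff_left] at h1
  exact le_of_mul_le_mul_left h1 (by positivity)

theorem exists_strict_support (hT : IsTriangulation P T) {f : E → ℝ} (hf : ConvexOn ℝ P f)
    (hlin : ∀ F, MaxCell T F → ∃ g : E →ᵃ[ℝ] ℝ, Set.EqOn f (⇑g) (convexHull ℝ (F : Set E)))
    (hdist : ∀ F G, MaxCell T F → MaxCell T G → F ≠ G → ¬ ∃ g : E →ᵃ[ℝ] ℝ,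
      Set.EqOn f (⇑g) (convexHull ℝ (F : Set E) ∪ convexHull ℝ (G : Set E)))
    {F : Finset E} (hF : MaxCell T F) :
    ∃ g : E →ᵃ[ℝ] ℝ, (∀ x ∈ F, g x = f x) ∧ ∀ v, {v} ∈ T → v ∉ F → g v < f v := by
  classical
  obtain ⟨g, hg⟩ := hlin F hF
  refine ⟨g, fun x hx => (hg (subset_convexHull ℝ _ hx)).symm, fun v hv hvF => ?_⟩
  have hvP : v ∈ P := hT.convexHull_subset hv (by simp)
  have hFP : ∀ x ∈ F, x ∈ P := fun x hx =>
    hT.convexHull_subset hF.1 (subset_convexHull ℝ _ hx)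
  refine lt_of_le_of_ne (hT.affine_le_of_convexOn hf hF hg v hvP) fun hgv => ?_
  obtain ⟨e, rank, he, hrank⟩ := exists_enumeration F
  let s : ℝ → ℝ := fun t => ∑ x ∈ F, t ^ (rank x + 1)
  let p : ℝ → E := fun t => v + ∑ x ∈ F, t ^ (rank x + 1) • (x - v)
  have hs : Continuous s := by fun_prop
  have hp : Continuous p := by fun_prop
  have hp0 : p 0 = v := by simp [p]
  have hC : Convex ℝ {x | x ∈ P ∧ f x ≤ g x} := by
    have hgc : ConcaveOn ℝ P g :=
      ⟨hf.1, fun x _ y _ a b _ _ hab => (Convex.combo_affine_apply (f := g) hab).ge⟩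
    convert (hf.sub hgc).convex_le 0 using 2
    simp
  have hpC : ∀ᶠ t in 𝓝[>] (0 : ℝ), p t ∈ {x | x ∈ P ∧ f x ≤ g x} := by
    have h1 : ∀ᶠ t in 𝓝[>] (0 : ℝ), s t < 1 :=
      (hs.continuousAt.eventually (gt_mem_nhds (by simp [s]))).filter_mono nhdsWithin_le_nhds
    filter_upwards [h1, self_mem_nhdsWithin] with t ht ht0
    have ht0' : (0 : ℝ) < t := ht0
    have hmem := hC.sum_mem (t := insert v F)
      (w := fun y => if y = v then 1 - s t else t ^ (rank y + 1))
      (z := id) ?_ ?_ ?_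
    · have hpt : p t = ∑ y ∈ insert v F,
          (if y = v then 1 - s t else t ^ (rank y + 1)) • id y := ?_
      · rw [hpt]; exact hmem
      rw [Finset.sum_insert hvF, Finset.sum_congr rfl fun x hx =>
        by rw [if_neg (ne_of_mem_of_not_mem hx hvF)]]
      simp only [p, if_true, id, smul_sub, Finset.sum_sub_distrib, ← Finset.sum_smul, sub_smul,
        one_smul, s]
      abel
    · intro y _
      by_cases hy : y = v
      · simp only [hy, if_true]; linarith
      · simp only [hy, if_false]; positivity
    · rw [Finset.sum_insert hvF, Finset.sum_congr rfl fun x hx =>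
        by rw [if_neg (ne_of_mem_of_not_mem hx hvF)]]
      simp [s]
    · intro y hy
      rcases Finset.mem_insert.1 hy with rfl | hy
      · exact ⟨hvP, hgv.ge⟩
      · exact ⟨hFP y hy, (hg (subset_convexHull ℝ _ hy)).le⟩
  obtain ⟨G, hG, hvG, hfr⟩ := hT.exists_maxCell_frequently hp (hpC.mono fun t h => h.1)
  rw [hp0] at hvG
  have hvG' : v ∈ G := hT.support_subset hv hG.1 (u := fun _ => 1) (fun _ => zero_le_one)
    (by simp) (by simpa using hvG) v (by simp) one_ne_zero
  have hFG : F ≠ G := fun h => hvF (h ▸ hvG')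
  obtain ⟨h, hh⟩ := hlin G hG
  have hhv : h v = g v := by rw [← hh hvG, hgv]
  let q : Polynomial ℝ := ∑ x ∈ F, Polynomial.C (h x - g x) * Polynomial.X ^ (rank x + 1)
  have hq : ∀ t, q.eval t = h (p t) - g (p t) := fun t => by
    have key : ∀ k : E →ᵃ[ℝ] ℝ,
        k (p t) = k v + ∑ x ∈ F, t ^ (rank x + 1) * (k x - k v) := fun k => by
      have h1 : k (p t) = k.linear (∑ x ∈ F, t ^ (rank x + 1) • (x - v)) + k v := by
        rw [← vadd_eq_add, ← AffineMap.map_vadd, vadd_eq_add, add_comm]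
      have h2 : ∀ x, k.linear (x - v) = k x - k v := fun x => k.linearMap_vsub x v
      rw [h1, map_sum, add_comm]
      simp only [map_smul, h2, smul_eq_mul]
    rw [key h, key g, hhv, Polynomial.eval_finsetSum, add_sub_add_left_eq_sub,
      ← Finset.sum_sub_distrib]
    refine Finset.sum_congr rfl fun x _ => ?_
    simp
    ring
  have hq0 : q = 0 := by
    by_contra hne
    obtain ⟨t, h1, h2, h3⟩ :=
      (hfr.and_eventually ((eventually_nhdsGT_eval_ne_zero hne).and hpC)).exists
    refine h2 ?_
    rw [hq, ← hh h1]
    exact sub_eq_zero.2 (le_antisymm h3.2 (hT.affine_le_of_convexOn hf hF hg _ h3.1))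
  have hhg : Set.EqOn h g (F : Set E) := fun x hx => by
    have h1 : q.coeff (rank x + 1) = h x - g x := by
      simp only [q, Polynomial.finsetSum_coeff, Polynomial.coeff_C_mul_X_pow]
      rw [Finset.sum_eq_single x]
      · simp
      · intro y hy hyx
        rw [if_neg]
        intro heq
        exact hyx (by rw [← (hrank y hy).2, ← (hrank x hx).2, Nat.succ_injective heq])
      · exact fun hx' => absurd hx hx'
    rw [hq0, Polynomial.coeff_zero] at h1
    linarith
  refine hdist F G hF hG hFG ⟨g, ?_⟩
  rintro x (hx | hx)
  · exact hg hx
  · rw [hh hx]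
    exact AffineMap.eqOn_affineSpan hhg
      (hT.subset_affineSpan hf.1 hF (hT.convexHull_subset hG.1 hx))

theorem isRegularTri_of_strict_support (hT : IsTriangulation P T) (hP : Convex ℝ P)
    (hne : P.Nonempty) {ω : E → ℝ}
    (hω : ∀ F, MaxCell T F →
      ∃ g : E →ᵃ[ℝ] ℝ, (∀ x ∈ F, g x = ω x) ∧ ∀ v, {v} ∈ T → v ∉ F → g v < ω v) :
    IsRegularTri P T := by
  classical
  choose! g hgF hglt using hω
  have hle : ∀ F G, MaxCell T F → G ∈ T → ∀ v ∈ G, g F v ≤ ω v := fun F G hF hG v hv => by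
    by_cases hvF : v ∈ F
    · exact (hgF F hF v hvF).le
    · exact (hglt F hF v (hT.singleton_mem hG hv) hvF).le
  have hlehull : ∀ F G, MaxCell T F → MaxCell T G → ∀ x ∈ convexHull ℝ (G : Set E),
      g F x ≤ g G x := fun F G hF hG x hx => by
    obtain ⟨w, w0, -, w1, rfl⟩ := exists_weights_of_mem_convexHull hx
    have h1 := AffineMap.apply_sum_smul (g F) G w id w1
    have h2 := AffineMap.apply_sum_smul (g G) G w id w1
    simp only [id] at h1 h2
    rw [h1, h2]
    refine Finset.sum_le_sum fun y hy => mul_le_mul_of_nonneg_left ?_ (w0 y)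
    rw [hgF G hG y hy]
    exact hle F G hF hG.1 y hy
  let M := T.filter (MaxCell T)
  have hM : M.Nonempty := by
    obtain ⟨x, hx⟩ := hne
    obtain ⟨F, hF, -⟩ := hT.exists_maxCell_of_mem hx
    exact ⟨F, Finset.mem_filter.2 ⟨hF.1, hF⟩⟩
  let f : E → ℝ := fun x => M.sup' hM fun F => g F x
  have hfeq : ∀ F, MaxCell T F → ∀ x ∈ convexHull ℝ (F : Set E), f x = g F x := fun F hF x hx =>
    le_antisymm (Finset.sup'_le _ _ fun G hG => hlehull G F (Finset.mem_filter.1 hG).2 hF x hx)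
      (Finset.le_sup' (fun F => g F x) (Finset.mem_filter.2 ⟨hF.1, hF⟩))
  refine ⟨f, ⟨hP, ?_⟩, fun F hF => ⟨g F, hfeq F hF⟩, ?_⟩
  · intro x _ y _ a b ha hb hab
    refine Finset.sup'_le _ _ fun F hF => ?_
    rw [Convex.combo_affine_apply (f := g F) hab]
    exact add_le_add
      (mul_le_mul_of_nonneg_left (Finset.le_sup' (fun F => g F x) hF) ha)
      (mul_le_mul_of_nonneg_left (Finset.le_sup' (fun F => g F y) hF) hb)
  · rintro F G hF hG hFG ⟨h, hh⟩
    obtain ⟨v, hvG, hvF⟩ : ∃ v ∈ G, v ∉ F := by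
      by_contra! H
      exact hFG (hG.2 F hF.1 H)
    have hvhull : v ∈ convexHull ℝ (G : Set E) := subset_convexHull ℝ _ hvG
    have h1 : Set.EqOn h (g F) (F : Set E) := fun x hx => by
      have hx' := subset_convexHull ℝ _ hx
      rw [← hh (Or.inl hx'), hfeq F hF x hx']
    have h2 := AffineMap.eqOn_affineSpan h1
      (hT.subset_affineSpan hP hF (hT.convexHull_subset hG.1 hvhull))
    have h3 := hglt F hF v (hT.singleton_mem hG.1 hvG) hvF
    rw [← h2, ← hh (Or.inr hvhull), hfeq G hG v hvhull, hgF G hG v hvG] at h3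
    exact lt_irrefl _ h3

end IsTriangulation

end Regular

section Interlacing

/-- Two integer sequences are interlaced up to `n` when their difference oscillates by at most
one. -/
def Interlaced (n : ℕ) (s t : ℕ → ℤ) : Prop :=
  ∀ k ≤ n, ∀ l ≤ n, |(s k - t k) - (s l - t l)| ≤ 1

theorem Interlaced.refl (n : ℕ) (s : ℕ → ℤ) : Interlaced n s s := fun k _ l _ => by simp

theorem Interlaced.symm {n : ℕ} {s t : ℕ → ℤ} (h : Interlaced n s t) : Interlaced n t s :=
  fun k hk l hl => by
    have := h k hk l hl
    rw [abs_le] at this ⊢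
    omega

variable {ι : Type*} {n : ℕ} {s : ι → ℕ → ℤ} {X : Finset ι}

theorem exists_window (hX : ∀ i ∈ X, ∀ j ∈ X, Interlaced n (s i) (s j)) :
    ∃ a : ℕ → ℕ → ℤ, ∀ i ∈ X, ∀ k ≤ n, ∀ l ≤ n,
      s i k - s i l = a k l ∨ s i k - s i l = a k l + 1 := by
  rcases X.eq_empty_or_nonempty with rfl | hne
  · exact ⟨fun _ _ => 0, by simp⟩
  · choose m hm hmin using fun k l => X.exists_min_image (fun i => s i k - s i l) hne
    refine ⟨fun k l => s (m k l) k - s (m k l) l, fun i hi k hk l hl => ?_⟩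
    have h1 := hmin k l i hi
    have h2 := hX i hi _ (hm k l) k hk l hl
    rw [abs_le] at h2
    dsimp only at h1 ⊢
    omega

/-- The sum of squared differences of a sequence. -/
def spread (n : ℕ) (s : ℕ → ℝ) : ℝ :=
  ∑ k ∈ Finset.range (n + 1), ∑ l ∈ Finset.range (n + 1), (s k - s l) ^ 2

/-- The affine function of the sequence `s` which interpolates `spread n s` where the difference
`s k - s l` lies in `{a k l, a k l + 1}` for all `k` and `l`. -/
def spreadMinorant (n : ℕ) (a : ℕ → ℕ → ℤ) (s : ℕ → ℝ) : ℝ :=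
  ∑ k ∈ Finset.range (n + 1), ∑ l ∈ Finset.range (n + 1),
    ((2 * a k l + 1 : ℝ) * (s k - s l) - a k l * (a k l + 1))

theorem spread_sub_spreadMinorant (a : ℕ → ℕ → ℤ) (t : ℕ → ℤ) :
    spread n (fun k => t k) - spreadMinorant n a (fun k => t k) =
      ∑ k ∈ Finset.range (n + 1), ∑ l ∈ Finset.range (n + 1),
        (((t k - t l - a k l) * (t k - t l - a k l - 1) : ℤ) : ℝ) := by
  simp only [spread, spreadMinorant, ← Finset.sum_sub_distrib]
  refine Finset.sum_congr rfl fun k _ => Finset.sum_congr rfl fun l _ => ?_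
  push_cast
  ring

theorem int_mul_sub_one_nonneg (x : ℤ) : 0 ≤ x * (x - 1) := by
  rcases le_or_gt x 0 with h | h <;> nlinarith

theorem spreadMinorant_le (a : ℕ → ℕ → ℤ) (t : ℕ → ℤ) :
    spreadMinorant n a (fun k => t k) ≤ spread n (fun k => t k) := by
  rw [← sub_nonneg, spread_sub_spreadMinorant]
  exact Finset.sum_nonneg fun k _ => Finset.sum_nonneg fun l _ =>
    Int.cast_nonneg (int_mul_sub_one_nonneg _)

theorem spreadMinorant_eq_iff (a : ℕ → ℕ → ℤ) (t : ℕ → ℤ) :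
    spreadMinorant n a (fun k => t k) = spread n (fun k => t k) ↔
      ∀ k ≤ n, ∀ l ≤ n, t k - t l = a k l ∨ t k - t l = a k l + 1 := by
  rw [eq_comm, ← sub_eq_zero, spread_sub_spreadMinorant, Finset.sum_eq_zero_iff_of_nonneg
    fun k _ => Finset.sum_nonneg fun l _ => Int.cast_nonneg (int_mul_sub_one_nonneg _)]
  constructor
  · intro h k hk l hl
    have h1 := (Finset.sum_eq_zero_iff_of_nonneg
      fun l _ => Int.cast_nonneg (int_mul_sub_one_nonneg _)).1
      (h k (Finset.mem_range.2 (by omega))) l (Finset.mem_range.2 (by omega))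
    rcases mul_eq_zero.1 (Int.cast_eq_zero.1 h1) with h2 | h2 <;> omega
  · intro h k hk
    refine Finset.sum_eq_zero fun l hl => ?_
    rw [Finset.mem_range] at hk hl
    rcases h k (by omega) l (by omega) with h | h <;> simp [h]

theorem interlaced_of_window {a : ℕ → ℕ → ℤ} {t u : ℕ → ℤ}
    (ht : ∀ k ≤ n, ∀ l ≤ n, t k - t l = a k l ∨ t k - t l = a k l + 1)
    (hu : ∀ k ≤ n, ∀ l ≤ n, u k - u l = a k l ∨ u k - u l = a k l + 1) :
    Interlaced n t u := fun k hk l hl => by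
  rw [abs_le]
  rcases ht k hk l hl with h | h <;> rcases hu k hk l hl with h' | h' <;> omega

theorem spreadMinorant_sum (a : ℕ → ℕ → ℤ) {w : ι → ℝ} (hw : ∑ i ∈ X, w i = 1)
    (s : ι → ℕ → ℝ) :
    spreadMinorant n a (fun k => ∑ i ∈ X, w i * s i k) =
      ∑ i ∈ X, w i * spreadMinorant n a (s i) := by
  symm
  simp only [spreadMinorant, Finset.mul_sum]
  rw [Finset.sum_comm]
  refine Finset.sum_congr rfl fun k _ => ?_
  rw [Finset.sum_comm]
  refine Finset.sum_congr rfl fun l _ => ?_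
  have h : ∀ i ∈ X, w i * ((2 * a k l + 1 : ℝ) * (s i k - s i l) - a k l * (a k l + 1)) =
      (2 * a k l + 1 : ℝ) * (w i * s i k - w i * s i l) - w i * (a k l * (a k l + 1)) :=
    fun i _ => by ring
  rw [Finset.sum_congr rfl h, Finset.sum_sub_distrib, ← Finset.mul_sum, Finset.sum_sub_distrib,
    ← Finset.sum_mul, hw, one_mul]

/-- Weights on an interlaced family of sequences lie in a subgroup of `ℝ` as soon as their sum and
the weighted sums of the entries do. -/
theorem mem_of_interlaced (H : AddSubgroup ℝ) (hX : ∀ i ∈ X, ∀ j ∈ X, Interlaced n (s i) (s j))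
    (h0 : ∀ i ∈ X, s i 0 = 0) (hinj : ∀ i ∈ X, ∀ j ∈ X, (∀ k ≤ n, s i k = s j k) → i = j)
    {w : ι → ℝ} (hw : ∑ i ∈ X, w i ∈ H) (hs : ∀ k ≤ n, ∑ i ∈ X, w i * s i k ∈ H) :
    ∀ i ∈ X, w i ∈ H := by
  classical
  have hmin : ∀ Y ⊆ X, Y.Nonempty →
      ∃ m ∈ Y, ∀ i ∈ Y, ∀ k ≤ n, s m k ≤ s i k ∧ s i k ≤ s m k + 1 := by
    intro Y hY hne
    obtain ⟨m, hm, hmin⟩ := Y.exists_min_image (fun i => ∑ k ∈ Finset.range (n + 1), s i k) hne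
    have hle : ∀ i ∈ Y, ∀ k ≤ n, s m k ≤ s i k := by
      intro i hi k hk
      by_contra! hlt
      have hall : ∀ l ≤ n, s i l ≤ s m l := fun l hl => by
        have h1 := hX i (hY hi) m (hY hm) k hk l hl
        have h2 := hX i (hY hi) m (hY hm) k hk 0 n.zero_le
        have h3 := hX i (hY hi) m (hY hm) l hl 0 n.zero_le
        rw [h0 i (hY hi), h0 m (hY hm)] at h2 h3
        rw [abs_le] at h1 h2 h3
        omega
      refine absurd (hmin i hi) (not_le.2 (Finset.sum_lt_sum (fun l hl => hall l ?_) ⟨k, ?_, hlt⟩))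
      · rw [Finset.mem_range] at hl; omega
      · rw [Finset.mem_range]; omega
    refine ⟨m, hm, fun i hi k hk => ⟨hle i hi k hk, ?_⟩⟩
    have h2 := hX i (hY hi) m (hY hm) k hk 0 n.zero_le
    rw [h0 i (hY hi), h0 m (hY hm), abs_le] at h2
    omega
  induction X using Finset.strongInduction with
  | H X ih =>
    rcases X.eq_empty_or_nonempty with rfl | hne
    · simp
    obtain ⟨m, hm, hm1⟩ := hmin X subset_rfl hne
    have hsum := Finset.add_sum_erase X w hm
    have herase : ∑ i ∈ X.erase m, w i ∈ H := by
      rcases (X.erase m).eq_empty_or_nonempty with he | hne'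
      · simp [he]
      obtain ⟨p, hp, hp1⟩ := hmin (X.erase m) (Finset.erase_subset _ _) hne'
      obtain ⟨hpm, hpX⟩ := Finset.mem_erase.1 hp
      obtain ⟨k, hk, hkne⟩ : ∃ k ≤ n, s p k ≠ s m k := by
        by_contra! H'
        exact hpm (hinj p hpX m hm H')
      have hpk : s p k = s m k + 1 := by have := hm1 p hpX k hk; omega
      have hik : ∀ i ∈ X.erase m, s i k = s m k + 1 := fun i hi => by
        have h1 := hp1 i hi k hk
        have h2 := hm1 i (Finset.mem_of_mem_erase hi) k hk
        omega
      have : ∑ i ∈ X.erase m, w i = ∑ i ∈ X, w i * s i k - s m k • ∑ i ∈ X, w i := by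
        have h1 : ∑ i ∈ X.erase m, w i * s i k = ∑ i ∈ X.erase m, w i * (s m k + 1) :=
          Finset.sum_congr rfl fun i hi => by rw [hik i hi]; push_cast; rfl
        rw [← Finset.add_sum_erase X (fun i => w i * s i k) hm, ← hsum, h1, ← Finset.sum_mul,
          zsmul_eq_mul]
        ring
      rw [this]
      exact H.sub_mem (hs k hk) (H.zsmul_mem hw _)
    have hwm : w m ∈ H := by
      rw [← hsum] at hw
      simpa using H.sub_mem hw herase
    intro i hi
    by_cases him : i = m
    · rwa [him]
    refine ih (X.erase m) (Finset.erase_ssubset hm)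
      (fun i hi j hj => hX i (Finset.mem_of_mem_erase hi) j (Finset.mem_of_mem_erase hj))
      (fun i hi => h0 i (Finset.mem_of_mem_erase hi))
      (fun i hi j hj => hinj i (Finset.mem_of_mem_erase hi) j (Finset.mem_of_mem_erase hj))
      herase (fun k hk => ?_) (fun Y hY => hmin Y (hY.trans (Finset.erase_subset _ _))) i
      (Finset.mem_erase.2 ⟨him, hi⟩)
    have h1 := hs k hk
    rw [← Finset.add_sum_erase X (fun i => w i * s i k) hm] at h1
    have h2 := H.zsmul_mem hwm (s m k)
    rw [zsmul_eq_mul, mul_comm] at h2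
    simpa using H.sub_mem h1 h2

theorem interlaced_floor_add {f : ℕ → ℝ} {t u : ℝ} (ht : t ∈ Set.Ico (0 : ℝ) 1)
    (hu : u ∈ Set.Ico (0 : ℝ) 1) : Interlaced n (fun k => ⌊f k + t⌋) (fun k => ⌊f k + u⌋) := by
  wlog h : t ≤ u generalizing t u
  · exact (this hu ht (le_of_not_ge h)).symm
  have key : ∀ k, ⌊f k + t⌋ ≤ ⌊f k + u⌋ ∧ ⌊f k + u⌋ ≤ ⌊f k + t⌋ + 1 := fun k =>
    ⟨Int.floor_mono (by linarith), by
      rw [← Int.floor_add_one]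
      exact Int.floor_mono (by linarith [hu.2, ht.1])⟩
  intro k _ l _
  have h1 := key k
  have h2 := key l
  rw [abs_le]
  dsimp only
  omega

theorem intervalIntegrable_floor_add (x a b : ℝ) :
    IntervalIntegrable (fun t => (⌊x + t⌋ : ℝ)) MeasureTheory.volume a b := by
  have : Monotone fun t : ℝ => (⌊x + t⌋ : ℝ) := fun s t h =>
    Int.cast_le.2 (Int.floor_mono (by linarith))
  exact this.intervalIntegrable

theorem integral_floor_add (x : ℝ) : ∫ t in (0 : ℝ)..1, (⌊x + t⌋ : ℝ) = x := by
  have hper : Function.Periodic (Int.fract : ℝ → ℝ) 1 := fun t => Int.fract_add_one t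
  have h01 : ∫ t in (0 : ℝ)..1, Int.fract t = 1 / 2 := by
    rw [intervalIntegral.integral_congr_Ioo_of_le (g := fun t => t) zero_le_one ?_]
    · simp
    · intro t ht
      exact Int.fract_eq_self.2 ⟨ht.1.le, ht.2⟩
  have h1 : ∫ t in (0 : ℝ)..1, Int.fract (x + t) = 1 / 2 := by
    rw [intervalIntegral.integral_comp_add_left (fun t => Int.fract t) x, add_zero,
      hper.intervalIntegral_add_eq x 0, zero_add, h01]
  have hlin : IntervalIntegrable (fun t : ℝ => x + t) MeasureTheory.volume 0 1 :=
    (by fun_prop : Continuous fun t : ℝ => x + t).intervalIntegrable _ _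
  have h2 : ∫ t in (0 : ℝ)..1, Int.fract (x + t) =
      (∫ t in (0 : ℝ)..1, (x + t)) - ∫ t in (0 : ℝ)..1, (⌊x + t⌋ : ℝ) := by
    rw [← intervalIntegral.integral_sub hlin (intervalIntegrable_floor_add x 0 1)]
    rfl
  have h3 : ∫ t in (0 : ℝ)..1, (x + t) = x + 1 / 2 := by
    rw [intervalIntegral.integral_add (by simp) (by simp)]
    simp
  linarith

end Interlacing

section Dilation

variable {E : Type*} [NormedAddCommGroup E] [NormedSpace ℝ E] {P : Set E} {T : Finset (Finset E)}
  {c : ℕ}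

/-- The dilation of a set by a natural number. -/
abbrev dilate (c : ℕ) (P : Set E) : Set E := (fun x => (c : ℝ) • x) '' P

/-- An enumeration of the vertices of `T`, together with barycentric coordinates (of total
weight `c`) on the dilation of `P`. -/
structure DilationCoords (P : Set E) (T : Finset (Finset E)) (c : ℕ) where
  verts : Finset E
  order : ℕ → E
  rank : E → ℕ
  coord : E → E → ℝ
  subset_verts : ∀ F ∈ T, F ⊆ verts
  order_mem : ∀ i < verts.card, order i ∈ verts
  rank_order : ∀ i < verts.card, rank (order i) = i
  rank_lt : ∀ x ∈ verts, rank x < verts.card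
  order_rank : ∀ x ∈ verts, order (rank x) = x
  coord_nonneg : ∀ y ∈ dilate c P, ∀ x, 0 ≤ coord y x
  coord_carrier : ∀ y ∈ dilate c P, ∃ F ∈ T, ∀ x, x ∉ F → coord y x = 0
  sum_coord : ∀ y ∈ dilate c P, ∑ x ∈ verts, coord y x = c
  sum_coord_smul : ∀ y ∈ dilate c P, ∑ x ∈ verts, coord y x • x = y

theorem IsTriangulation.nonempty_dilationCoords (hT : IsTriangulation P T) (c : ℕ) :
    Nonempty (DilationCoords P T c) := by
  classical
  obtain ⟨order, rank, h1, h2⟩ := exists_enumeration (T.biUnion id)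
  have hsub : ∀ F ∈ T, F ⊆ T.biUnion id := fun F hF => Finset.subset_biUnion_of_mem id hF
  have hex : ∀ y : E, ∃ w : E → ℝ, y ∈ dilate c P → (∀ x, 0 ≤ w x) ∧
      (∃ F ∈ T, ∀ x, x ∉ F → w x = 0) ∧ ∑ x ∈ T.biUnion id, w x = c ∧
      ∑ x ∈ T.biUnion id, w x • x = y := by
    intro y
    by_cases hy : y ∈ dilate c P
    · obtain ⟨z, hz, rfl⟩ := hy
      obtain ⟨F, hF, hzF⟩ := hT.exists_face hz
      obtain ⟨w, w0, wF, w1, rfl⟩ := exists_weights_of_mem_convexHull hzF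
      refine ⟨fun x => c * w x, fun _ => ⟨fun x => mul_nonneg c.cast_nonneg (w0 x),
        ⟨F, hF, fun x hx => by simp [wF x hx]⟩, ?_, ?_⟩⟩
      · rw [← Finset.mul_sum, ← Finset.sum_subset (hsub F hF) fun x _ hx => wF x hx, w1, mul_one]
      · simp only [mul_smul, ← Finset.smul_sum]
        rw [← Finset.sum_subset (hsub F hF) fun x _ hx => by rw [wF x hx, zero_smul]]
    · exact ⟨0, fun h => absurd h hy⟩
  choose coord hcoord using hex
  exact ⟨⟨T.biUnion id, order, rank, coord, hsub, fun i hi => (h1 i hi).1, fun i hi => (h1 i hi).2,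
    fun x hx => (h2 x hx).1, fun x hx => (h2 x hx).2, fun y hy => (hcoord y hy).1,
    fun y hy => (hcoord y hy).2.1, fun y hy => (hcoord y hy).2.2.1,
    fun y hy => (hcoord y hy).2.2.2⟩⟩

namespace DilationCoords

variable (D : DilationCoords P T c)

theorem sum_verts {M : Type*} [AddCommMonoid M] {F : Finset E} (hF : F ∈ T) {f : E → M}
    (hf : ∀ x, x ∉ F → f x = 0) : ∑ x ∈ D.verts, f x = ∑ x ∈ F, f x :=
  (Finset.sum_subset (D.subset_verts F hF) fun x _ hx => hf x hx).symm

theorem mem_dilate_and_coord_eq (hT : IsTriangulation P T) (hc : 0 < c) {w : E → ℝ} {y : E}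
    (w0 : ∀ x, 0 ≤ w x) {F : Finset E} (hF : F ∈ T) (wF : ∀ x, x ∉ F → w x = 0)
    (w1 : ∑ x ∈ D.verts, w x = c) (hy : ∑ x ∈ D.verts, w x • x = y) :
    y ∈ dilate c P ∧ D.coord y = w := by
  have hc' : (c : ℝ) ≠ 0 := by exact_mod_cast hc.ne'
  have hci : (0 : ℝ) ≤ (c : ℝ)⁻¹ := by positivity
  have hsum : ∀ {G : Finset E} {u : E → ℝ}, G ∈ T → (∀ x, x ∉ G → u x = 0) →
      ∑ x ∈ D.verts, u x = c → ∑ x ∈ G, (c : ℝ)⁻¹ * u x = 1 := fun hG uG u1 => by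
    rw [← Finset.mul_sum, ← D.sum_verts hG uG, u1, inv_mul_cancel₀ hc']
  have hpt : ∀ {G : Finset E} {u : E → ℝ}, G ∈ T → (∀ x, x ∉ G → u x = 0) →
      ∑ x ∈ D.verts, u x • x = y → ∑ x ∈ G, ((c : ℝ)⁻¹ * u x) • x = (c : ℝ)⁻¹ • y :=
    fun hG uG u1 => by
      simp only [mul_smul, ← Finset.smul_sum]
      rw [← D.sum_verts hG fun x hx => by rw [uG x hx, zero_smul], u1]
  have hmem : y ∈ dilate c P := by
    refine ⟨(c : ℝ)⁻¹ • y, hT.convexHull_subset hF ?_, smul_inv_smul₀ hc' y⟩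
    rw [← hpt hF wF hy]
    exact sum_smul_mem_convexHull (fun x => mul_nonneg hci (w0 x)) (hsum hF wF w1)
  refine ⟨hmem, ?_⟩
  obtain ⟨G, hG, hyG⟩ := D.coord_carrier y hmem
  have key := hT.weights_ext hG hF (u := fun x => (c : ℝ)⁻¹ * D.coord y x)
    (w := fun x => (c : ℝ)⁻¹ * w x)
    (fun x => mul_nonneg hci (D.coord_nonneg y hmem x)) (fun x => mul_nonneg hci (w0 x))
    (fun x hx => by simp [hyG x hx]) (fun x hx => by simp [wF x hx])
    (hsum hG hyG (D.sum_coord y hmem)) (hsum hF wF w1)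
    ((hpt hG hyG (D.sum_coord_smul y hmem)).trans (hpt hF wF hy).symm)
  funext x
  exact mul_left_cancel₀ (inv_ne_zero hc') (congrFun key x)

/-- Partial sums of a weight function along the enumeration of the vertices. -/
def psum (w : E → ℝ) (k : ℕ) : ℝ := ∑ i ∈ Finset.range k, w (D.order i)

theorem psum_succ (w : E → ℝ) (k : ℕ) : D.psum w (k + 1) = D.psum w k + w (D.order k) :=
  Finset.sum_range_succ _ _

theorem psum_card (w : E → ℝ) : D.psum w D.verts.card = ∑ x ∈ D.verts, w x := by
  refine Finset.sum_nbij' D.order D.rank (fun i hi => D.order_mem i (Finset.mem_range.1 hi))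
    (fun x hx => Finset.mem_range.2 (D.rank_lt x hx))
    (fun i hi => D.rank_order i (Finset.mem_range.1 hi)) (fun x hx => D.order_rank x hx)
    fun i _ => rfl

theorem psum_sum {ι : Type*} (X : Finset ι) (u : ι → ℝ) (w : ι → E → ℝ) (k : ℕ) :
    D.psum (fun x => ∑ i ∈ X, u i * w i x) k = ∑ i ∈ X, u i * D.psum (w i) k := by
  simp only [psum, Finset.mul_sum]
  exact Finset.sum_comm

/-- The points of the dilation with integer barycentric coordinates. -/
def IsVertex (y : E) : Prop := y ∈ dilate c P ∧ ∀ x, ∃ z : ℤ, D.coord y x = z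

theorem finite_isVertex : {y | D.IsVertex y}.Finite := by
  classical
  refine (Set.finite_range fun m : D.verts → Fin (c + 1) =>
    ∑ x : D.verts, ((m x : ℕ) : ℝ) • (x : E)).subset ?_
  rintro y ⟨hy, hz⟩
  have hex : ∀ x : D.verts, ∃ m : Fin (c + 1), ((m : ℕ) : ℝ) = D.coord y x := fun x => by
    obtain ⟨z, hz⟩ := hz x
    have h0 := D.coord_nonneg y hy x
    have h1 : D.coord y x ≤ c := by
      rw [← D.sum_coord y hy]
      exact Finset.single_le_sum (fun x _ => D.coord_nonneg y hy x) x.2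
    rw [hz] at h0 h1
    have h0' : 0 ≤ z := by exact_mod_cast h0
    have h1' : z ≤ c := by exact_mod_cast h1
    refine ⟨⟨z.toNat, by omega⟩, ?_⟩
    rw [hz]
    exact_mod_cast Int.toNat_of_nonneg h0'
  choose m hm using hex
  refine ⟨m, ?_⟩
  simp only [hm]
  exact (Finset.sum_coe_sort D.verts fun x => D.coord y x • x).trans (D.sum_coord_smul y hy)

/-- The integer partial sums of the coordinates of a point. -/
noncomputable def seq (y : E) (k : ℕ) : ℤ := ∑ i ∈ Finset.range k, ⌊D.coord y (D.order i)⌋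

theorem seq_zero (y : E) : D.seq y 0 = 0 := rfl

variable {D}

theorem IsVertex.seq_eq {y : E} (hy : D.IsVertex y) (k : ℕ) :
    (D.seq y k : ℝ) = D.psum (D.coord y) k := by
  rw [seq, psum, Int.cast_sum]
  refine Finset.sum_congr rfl fun i _ => ?_
  obtain ⟨z, hz⟩ := hy.2 (D.order i)
  rw [hz, Int.floor_intCast]

theorem IsVertex.ext {y z : E} (hy : D.IsVertex y) (hz : D.IsVertex z)
    (h : ∀ k ≤ D.verts.card, D.seq y k = D.seq z k) : y = z := by
  rw [← D.sum_coord_smul y hy.1, ← D.sum_coord_smul z hz.1]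
  refine Finset.sum_congr rfl fun x hx => ?_
  have hr := D.rank_lt x hx
  have h1 := D.psum_succ (D.coord y) (D.rank x)
  have h2 := D.psum_succ (D.coord z) (D.rank x)
  rw [D.order_rank x hx, ← hy.seq_eq, ← hy.seq_eq, h _ hr, h _ hr.le] at h1
  rw [D.order_rank x hx, ← hz.seq_eq, ← hz.seq_eq] at h2
  congr 1
  linarith

variable (D)

open Classical in
/-- The canonical triangulation of the dilation: its cells are the interlaced sets of points with
integer coordinates which are carried by a common cell of `T`. -/
noncomputable def cells : Finset (Finset E) :=
  D.finite_isVertex.toFinset.powerset.filter fun F =>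
    (∃ G ∈ T, ∀ y ∈ F, ∀ x, x ∉ G → D.coord y x = 0) ∧
      ∀ y ∈ F, ∀ z ∈ F, Interlaced D.verts.card (D.seq y) (D.seq z)

theorem mem_cells {F : Finset E} : F ∈ D.cells ↔ (∀ y ∈ F, D.IsVertex y) ∧
    (∃ G ∈ T, ∀ y ∈ F, ∀ x, x ∉ G → D.coord y x = 0) ∧
      ∀ y ∈ F, ∀ z ∈ F, Interlaced D.verts.card (D.seq y) (D.seq z) := by
  simp [cells, Finset.subset_iff]

theorem singleton_mem_cells {y : E} : {y} ∈ D.cells ↔ D.IsVertex y := by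
  rw [mem_cells]
  refine ⟨fun h => h.1 y (by simp), fun h => ⟨by simpa using h, ?_, ?_⟩⟩
  · obtain ⟨F, hF, hy⟩ := D.coord_carrier y h.1
    exact ⟨F, hF, by simpa using hy⟩
  · simpa using Interlaced.refl _ _

theorem cells_down {F G : Finset E} (hF : F ∈ D.cells) (hGF : G ⊆ F) : G ∈ D.cells := by
  rw [mem_cells] at hF ⊢
  obtain ⟨h1, ⟨H, hH, h2⟩, h3⟩ := hF
  exact ⟨fun y hy => h1 y (hGF hy), ⟨H, hH, fun y hy => h2 y (hGF hy)⟩,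
    fun y hy z hz => h3 y (hGF hy) z (hGF hz)⟩

theorem sum_smul_eq {F : Finset E} (hF : F ∈ D.cells) (w : E → ℝ) :
    ∑ x ∈ D.verts, (∑ y ∈ F, w y * D.coord y x) • x = ∑ y ∈ F, w y • y := by
  simp only [Finset.sum_smul, mul_smul]
  rw [Finset.sum_comm]
  refine Finset.sum_congr rfl fun y hy => ?_
  rw [← Finset.smul_sum, D.sum_coord_smul y (((D.mem_cells).1 hF).1 y hy).1]

theorem sum_sum_coord {F : Finset E} (hF : F ∈ D.cells) (w : E → ℝ) :
    ∑ x ∈ D.verts, ∑ y ∈ F, w y * D.coord y x = (∑ y ∈ F, w y) * c := by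
  rw [Finset.sum_comm, Finset.sum_mul]
  refine Finset.sum_congr rfl fun y hy => ?_
  rw [← Finset.mul_sum, D.sum_coord y (((D.mem_cells).1 hF).1 y hy).1]

theorem mem_dilate_and_coord_sum (hT : IsTriangulation P T) (hc : 0 < c) {F : Finset E}
    (hF : F ∈ D.cells) {w : E → ℝ} (w0 : ∀ y, 0 ≤ w y) (w1 : ∑ y ∈ F, w y = 1) :
    ∑ y ∈ F, w y • y ∈ dilate c P ∧
      D.coord (∑ y ∈ F, w y • y) = fun x => ∑ y ∈ F, w y * D.coord y x := by
  obtain ⟨hv, ⟨G, hG, hFG⟩, -⟩ := (D.mem_cells).1 hF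
  refine D.mem_dilate_and_coord_eq hT hc (fun x => Finset.sum_nonneg fun y hy =>
    mul_nonneg (w0 y) (D.coord_nonneg y (hv y hy).1 x)) hG
    (fun x hx => Finset.sum_eq_zero fun y hy => by rw [hFG y hy x hx, mul_zero]) ?_ ?_
  · rw [D.sum_sum_coord hF, w1, one_mul]
  · exact D.sum_smul_eq hF w

theorem psum_coord_sum (hT : IsTriangulation P T) (hc : 0 < c) {F : Finset E}
    (hF : F ∈ D.cells) {w : E → ℝ} (w0 : ∀ y, 0 ≤ w y) (w1 : ∑ y ∈ F, w y = 1) (k : ℕ) :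
    D.psum (D.coord (∑ y ∈ F, w y • y)) k = ∑ y ∈ F, w y * (D.seq y k : ℝ) := by
  rw [(D.mem_dilate_and_coord_sum hT hc hF w0 w1).2, psum_sum]
  exact Finset.sum_congr rfl fun y hy => by rw [(((D.mem_cells).1 hF).1 y hy).seq_eq]

theorem weights_ext (hT : IsTriangulation P T) (hc : 0 < c) {F G : Finset E}
    (hF : F ∈ D.cells) (hG : G ∈ D.cells) {u w : E → ℝ}
    (u0 : ∀ y, 0 ≤ u y) (w0 : ∀ y, 0 ≤ w y) (uF : ∀ y, y ∉ F → u y = 0)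
    (wG : ∀ y, y ∉ G → w y = 0) (u1 : ∑ y ∈ F, u y = 1) (w1 : ∑ y ∈ G, w y = 1)
    (h : ∑ y ∈ F, u y • y = ∑ y ∈ G, w y • y) : u = w := by
  classical
  obtain ⟨hFv, -, hFi⟩ := (D.mem_cells).1 hF
  obtain ⟨hGv, -, hGi⟩ := (D.mem_cells).1 hG
  have hS : ∀ k, ∑ y ∈ F, u y * (D.seq y k : ℝ) = ∑ y ∈ G, w y * (D.seq y k : ℝ) := fun k => by
    rw [← D.psum_coord_sum hT hc hF u0 u1, ← D.psum_coord_sum hT hc hG w0 w1, h]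
  obtain ⟨a, ha⟩ := exists_window hFi
  obtain ⟨b, hb⟩ := exists_window hGi
  set n := D.verts.card
  have key : ∀ (d : ℕ → ℕ → ℤ) (y : E),
      spreadMinorant n d (fun k => D.seq y k) ≤ spread n (fun k => D.seq y k) :=
    fun d y => spreadMinorant_le d _
  have e1 : ∀ d : ℕ → ℕ → ℤ, ∑ y ∈ F, u y * spreadMinorant n d (fun k => D.seq y k) =
      ∑ y ∈ G, w y * spreadMinorant n d (fun k => D.seq y k) := fun d => by
    rw [← spreadMinorant_sum d u1, ← spreadMinorant_sum d w1]
    simp only [hS]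
  have eF : ∑ y ∈ F, u y * spreadMinorant n a (fun k => D.seq y k) =
      ∑ y ∈ F, u y * spread n (fun k => D.seq y k) := Finset.sum_congr rfl fun y hy => by
    rw [(spreadMinorant_eq_iff a (D.seq y)).2 (ha y hy)]
  have eG : ∑ y ∈ G, w y * spreadMinorant n b (fun k => D.seq y k) =
      ∑ y ∈ G, w y * spread n (fun k => D.seq y k) := Finset.sum_congr rfl fun y hy => by
    rw [(spreadMinorant_eq_iff b (D.seq y)).2 (hb y hy)]
  have leF : ∑ y ∈ F, u y * spreadMinorant n b (fun k => D.seq y k) ≤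
      ∑ y ∈ F, u y * spread n (fun k => D.seq y k) :=
    Finset.sum_le_sum fun y _ => mul_le_mul_of_nonneg_left (key b y) (u0 y)
  have leG : ∀ y ∈ G, w y * spreadMinorant n a (fun k => D.seq y k) ≤
      w y * spread n (fun k => D.seq y k) :=
    fun y _ => mul_le_mul_of_nonneg_left (key a y) (w0 y)
  have heq := (Finset.sum_eq_sum_iff_of_le leG).1
    (le_antisymm (Finset.sum_le_sum leG) (by rw [← eG, ← e1 b, ← e1 a, eF]; exact leF))
  have hGa : ∀ y ∈ G, w y ≠ 0 → ∀ k ≤ n, ∀ l ≤ n,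
      D.seq y k - D.seq y l = a k l ∨ D.seq y k - D.seq y l = a k l + 1 := fun y hy hne =>
    (spreadMinorant_eq_iff a (D.seq y)).1 (mul_left_cancel₀ hne (heq y hy))
  let X := (F ∪ G).filter fun y => y ∈ F ∨ w y ≠ 0
  have hXF : F ⊆ X := fun y hy => Finset.mem_filter.2 ⟨Finset.mem_union_left _ hy, Or.inl hy⟩
  have hXG : ∀ y ∈ X, y ∉ F → y ∈ G ∧ w y ≠ 0 := fun y hy hyF => by
    obtain ⟨h1, h2⟩ := Finset.mem_filter.1 hy
    exact ⟨(Finset.mem_union.1 h1).resolve_left hyF, h2.resolve_left hyF⟩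
  have hXv : ∀ y ∈ X, D.IsVertex y := fun y hy => by
    by_cases hyF : y ∈ F
    · exact hFv y hyF
    · exact hGv y (hXG y hy hyF).1
  have hXa : ∀ y ∈ X, ∀ k ≤ n, ∀ l ≤ n,
      D.seq y k - D.seq y l = a k l ∨ D.seq y k - D.seq y l = a k l + 1 := fun y hy => by
    by_cases hyF : y ∈ F
    · exact ha y hyF
    · exact hGa y (hXG y hy hyF).1 (hXG y hy hyF).2
  have hsum : ∀ f : E → ℝ,
      ∑ y ∈ X, (u y - w y) * f y = ∑ y ∈ F, u y * f y - ∑ y ∈ G, w y * f y := by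
    intro f
    simp only [sub_mul, Finset.sum_sub_distrib]
    congr 1
    · exact (Finset.sum_subset hXF fun y _ hy => by rw [uF y hy, zero_mul]).symm
    · refine Finset.sum_subset_zero_on_sdiff (f := fun y => w y * f y) (g := fun y => w y * f y)
        (s₁ := X.filter (· ∈ G)) (s₂ := X) (Finset.filter_subset _ _) ?_ (fun _ _ => rfl)
        |>.symm.trans (Finset.sum_subset ?_ ?_)
      · intro y hy
        rw [wG y (fun hyG => (Finset.mem_sdiff.1 hy).2
          (Finset.mem_filter.2 ⟨(Finset.mem_sdiff.1 hy).1, hyG⟩)), zero_mul]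
      · exact fun y hy => (Finset.mem_filter.1 hy).2
      · intro y hyG hy
        by_cases hw : w y = 0
        · rw [hw, zero_mul]
        · exact absurd (Finset.mem_filter.2 ⟨Finset.mem_filter.2
            ⟨Finset.mem_union_right _ hyG, Or.inr hw⟩, hyG⟩) hy
  have hX := mem_of_interlaced (X := X) (s := D.seq) (n := n) (w := fun y => u y - w y) ⊥
    (fun y hy z hz => interlaced_of_window (hXa y hy) (hXa z hz)) (fun y _ => D.seq_zero y)
    (fun y hy z hz hyz => (hXv y hy).ext (hXv z hz) hyz)
    (by simpa [u1, w1] using hsum fun _ => 1)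
    (fun k _ => by
      rw [AddSubgroup.mem_bot]
      exact (hsum fun y => D.seq y k).trans (sub_eq_zero.2 (hS k)))
  funext y
  by_cases hy : y ∈ X
  · exact sub_eq_zero.1 (AddSubgroup.mem_bot.1 (hX y hy))
  · rw [uF y fun h => hy (hXF h)]
    by_contra hne
    have hyG : y ∈ G := by_contra fun h => hne (wG y h).symm
    exact hy (Finset.mem_filter.2 ⟨Finset.mem_union_right _ hyG, Or.inr (Ne.symm hne)⟩)

end DilationCoords

end Dilation

section Covering

variable {E : Type*} [NormedAddCommGroup E] [NormedSpace ℝ E] {P : Set E} {T : Finset (Finset E)}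
  {c : ℕ}

namespace DilationCoords

variable (D : DilationCoords P T c)

/-- Integer weights obtained by rounding down the partial sums of the coordinates of `y`, shifted
by `t`. -/
noncomputable def roundedWeight (y : E) (t : ℝ) (x : E) : ℤ :=
  open Classical in
  if x ∈ D.verts then
    ⌊D.psum (D.coord y) (D.rank x + 1) + t⌋ - ⌊D.psum (D.coord y) (D.rank x) + t⌋
  else 0

/-- The point of the dilation with coordinates `D.roundedWeight y t`. -/
noncomputable def roundedPoint (y : E) (t : ℝ) : E :=
  ∑ x ∈ D.verts, (D.roundedWeight y t x : ℝ) • x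

theorem psum_rank_succ (w : E → ℝ) {x : E} (hx : x ∈ D.verts) :
    D.psum w (D.rank x + 1) = D.psum w (D.rank x) + w x := by
  rw [psum_succ, D.order_rank x hx]

variable {D}

theorem roundedWeight_nonneg {y : E} (hy : y ∈ dilate c P) (t : ℝ) (x : E) :
    0 ≤ D.roundedWeight y t x := by
  unfold roundedWeight
  split_ifs with hx
  · rw [D.psum_rank_succ _ hx, sub_nonneg]
    exact Int.floor_mono (by linarith [D.coord_nonneg y hy x])
  · exact le_rfl

theorem roundedWeight_eq_zero {y : E} (t : ℝ) {x : E} (h : D.coord y x = 0) :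
    D.roundedWeight y t x = 0 := by
  unfold roundedWeight
  split_ifs with hx
  · rw [D.psum_rank_succ _ hx, h, add_zero, sub_self]
  · rfl

theorem psum_roundedWeight (y : E) {t : ℝ} (ht : t ∈ Set.Ico (0 : ℝ) 1) {k : ℕ}
    (hk : k ≤ D.verts.card) :
    D.psum (fun x => D.roundedWeight y t x) k = ⌊D.psum (D.coord y) k + t⌋ := by
  induction k with
  | zero =>
    have : ⌊t⌋ = 0 := Int.floor_eq_zero_iff.2 ht
    simp [psum, this]
  | succ k ih =>
    rw [psum_succ, ih (by omega), roundedWeight, if_pos (D.order_mem k hk), D.rank_order k hk]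
    push_cast
    ring

theorem sum_roundedWeight {y : E} (hy : y ∈ dilate c P) {t : ℝ} (ht : t ∈ Set.Ico (0 : ℝ) 1) :
    ∑ x ∈ D.verts, (D.roundedWeight y t x : ℝ) = c := by
  rw [← D.psum_card, psum_roundedWeight y ht le_rfl, psum_card, D.sum_coord y hy]
  have : ⌊t⌋ = 0 := Int.floor_eq_zero_iff.2 ht
  simp [this]

theorem roundedPoint_spec (hT : IsTriangulation P T) (hc : 0 < c) {y : E} (hy : y ∈ dilate c P)
    {t : ℝ} (ht : t ∈ Set.Ico (0 : ℝ) 1) :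
    D.roundedPoint y t ∈ dilate c P ∧
      D.coord (D.roundedPoint y t) = fun x => (D.roundedWeight y t x : ℝ) := by
  obtain ⟨F, hF, hyF⟩ := D.coord_carrier y hy
  exact D.mem_dilate_and_coord_eq hT hc (fun x => Int.cast_nonneg (roundedWeight_nonneg hy t x))
    hF (fun x hx => by rw [roundedWeight_eq_zero t (hyF x hx), Int.cast_zero])
    (sum_roundedWeight hy ht) rfl

theorem isVertex_roundedPoint (hT : IsTriangulation P T) (hc : 0 < c) {y : E}
    (hy : y ∈ dilate c P) {t : ℝ} (ht : t ∈ Set.Ico (0 : ℝ) 1) :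
    D.IsVertex (D.roundedPoint y t) := by
  obtain ⟨h1, h2⟩ := D.roundedPoint_spec hT hc hy ht
  exact ⟨h1, fun x => ⟨_, congrFun h2 x⟩⟩

theorem seq_roundedPoint (hT : IsTriangulation P T) (hc : 0 < c) {y : E}
    (hy : y ∈ dilate c P) {t : ℝ} (ht : t ∈ Set.Ico (0 : ℝ) 1) {k : ℕ} (hk : k ≤ D.verts.card) :
    D.seq (D.roundedPoint y t) k = ⌊D.psum (D.coord y) k + t⌋ := by
  have := (D.isVertex_roundedPoint hT hc hy ht).seq_eq k
  rw [(D.roundedPoint_spec hT hc hy ht).2, psum_roundedWeight y ht hk] at this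
  exact_mod_cast this

theorem intervalIntegrable_roundedWeight (y x : E) :
    IntervalIntegrable (fun t => (D.roundedWeight y t x : ℝ)) MeasureTheory.volume 0 1 := by
  unfold roundedWeight
  split_ifs with hx
  · push_cast
    exact (intervalIntegrable_floor_add _ _ _).sub (intervalIntegrable_floor_add _ _ _)
  · simp

theorem integral_roundedWeight (y : E) {x : E} (hx : x ∈ D.verts) :
    ∫ t in (0 : ℝ)..1, (D.roundedWeight y t x : ℝ) = D.coord y x := by
  simp only [roundedWeight, if_pos hx]
  push_cast
  rw [intervalIntegral.integral_sub (intervalIntegrable_floor_add _ _ _)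
    (intervalIntegrable_floor_add _ _ _), integral_floor_add, integral_floor_add,
    D.psum_rank_succ _ hx]
  ring

theorem exists_cell_mem_convexHull [FiniteDimensional ℝ E] (hT : IsTriangulation P T) (hc : 0 < c)
    {y : E} (hy : y ∈ dilate c P) : ∃ F ∈ D.cells, y ∈ convexHull ℝ (F : Set E) := by
  classical
  have : CompleteSpace E := FiniteDimensional.complete ℝ E
  let F := D.finite_isVertex.toFinset.filter
    fun z => ∃ t ∈ Set.Ico (0 : ℝ) 1, D.roundedPoint y t = z
  refine ⟨F, D.mem_cells.2 ⟨fun z hz => ?_, ?_, ?_⟩, ?_⟩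
  · simpa using (Finset.mem_filter.1 hz).1
  · obtain ⟨G, hG, hyG⟩ := D.coord_carrier y hy
    refine ⟨G, hG, fun z hz x hx => ?_⟩
    obtain ⟨t, ht, rfl⟩ := (Finset.mem_filter.1 hz).2
    rw [(D.roundedPoint_spec hT hc hy ht).2]
    exact Int.cast_eq_zero.2 (roundedWeight_eq_zero t (hyG x hx))
  · intro z hz z' hz'
    obtain ⟨t, ht, rfl⟩ := (Finset.mem_filter.1 hz).2
    obtain ⟨u, hu, rfl⟩ := (Finset.mem_filter.1 hz').2
    intro k hk l hl
    rw [seq_roundedPoint hT hc hy ht hk, seq_roundedPoint hT hc hy ht hl,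
      seq_roundedPoint hT hc hy hu hk, seq_roundedPoint hT hc hy hu hl]
    exact interlaced_floor_add ht hu k hk l hl
  · have hi : ∀ x : E, IntervalIntegrable (fun t => (D.roundedWeight y t x : ℝ) • x)
        MeasureTheory.volume 0 1 := fun x =>
      have h := D.intervalIntegrable_roundedWeight y x
      ⟨h.1.smul_const x, h.2.smul_const x⟩
    have hint : ∫ t in (0 : ℝ)..1, D.roundedPoint y t = y := by
      simp only [roundedPoint]
      rw [intervalIntegral.integral_finsetSum fun x _ => hi x]
      conv_rhs => rw [← D.sum_coord_smul y hy]
      refine Finset.sum_congr rfl fun x hx => ?_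
      rw [intervalIntegral.integral_smul_const, integral_roundedWeight y hx]
    have hintble : IntervalIntegrable (D.roundedPoint y) MeasureTheory.volume 0 1 := by
      have h : D.roundedPoint y = ∑ x ∈ D.verts, fun t => (D.roundedWeight y t x : ℝ) • x := by
        funext t
        rw [Finset.sum_apply]
        rfl
      rw [h]
      exact IntervalIntegrable.sum D.verts fun x _ => hi x
    rw [← hint, intervalIntegral.integral_of_le zero_le_one,
      MeasureTheory.integral_Ioc_eq_integral_Ioo]
    have : MeasureTheory.IsProbabilityMeasure
        (MeasureTheory.volume.restrict (Set.Ioo (0 : ℝ) 1)) := ⟨by simp⟩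
    refine (convex_convexHull ℝ _).integral_mem
      (F.finite_toSet.isCompact_convexHull ℝ).isClosed ?_ ?_
    · refine (MeasureTheory.ae_restrict_mem measurableSet_Ioo).mono fun t ht => ?_
      have ht' : t ∈ Set.Ico (0 : ℝ) 1 := ⟨ht.1.le, ht.2⟩
      refine subset_convexHull ℝ _ (Finset.mem_coe.2 (Finset.mem_filter.2 ⟨?_, t, ht', rfl⟩))
      simpa using D.isVertex_roundedPoint hT hc hy ht'
    · exact (intervalIntegrable_iff_integrableOn_Ioo_of_le zero_le_one).1 hintble

theorem isTriangulation_cells [FiniteDimensional ℝ E] (hT : IsTriangulation P T) (hc : 0 < c) :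
    IsTriangulation (dilate c P) D.cells := by
  refine isTriangulation_of_weights_unique (fun F hF G hGF => D.cells_down hF hGF)
    (fun F hF x hx => ?_) (fun y hy => exists_cell_mem_convexHull hT hc hy)
    fun F hF G hG u w u0 w0 uF wG u1 w1 h => D.weights_ext hT hc hF hG u0 w0 uF wG u1 w1 h
  obtain ⟨w, w0, -, w1, rfl⟩ := exists_weights_of_mem_convexHull hx
  exact (D.mem_dilate_and_coord_sum hT hc hF w0 w1).1

end DilationCoords

end Covering

section Unimodular

variable {E : Type*} [NormedAddCommGroup E] [NormedSpace ℝ E] {P : Set E} {T : Finset (Finset E)}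
  {c : ℕ}

theorem sum_int_smul_mem (Λ : AddSubgroup E) {F : Finset E} (hF : ∀ x ∈ F, x ∈ Λ) {w : E → ℝ}
    (hw : ∀ x, ∃ z : ℤ, w x = z) : ∑ x ∈ F, w x • x ∈ Λ := by
  refine Λ.sum_mem fun x hx => ?_
  obtain ⟨z, hz⟩ := hw x
  rw [hz, Int.cast_smul_eq_zsmul]
  exact Λ.zsmul_mem (hF x hx) z

namespace DilationCoords

variable (D : DilationCoords P T c)

theorem isUnimodular_cells [FiniteDimensional ℝ E] (Λ : AddSubgroup E) (hT : IsTriangulation P T)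
    (hc : 0 < c) (hU : IsUnimodular (· ∈ Λ) T) : IsUnimodular (· ∈ Λ) D.cells := by
  classical
  intro X hX
  obtain ⟨hv, ⟨G, hG, hXG⟩, hi⟩ := D.mem_cells.1 hX.1
  obtain ⟨F, hF, hGF⟩ := exists_maxCell_superset hG
  obtain ⟨hFΛ, hFi, hFl⟩ := hU F hF
  have hXF : ∀ y ∈ X, ∀ x, x ∉ F → D.coord y x = 0 := fun y hy x hx =>
    hXG y hy x fun h => hx (hGF h)
  refine ⟨fun y hy => ?_, (D.isTriangulation_cells hT hc).1 X hX.1, fun q hq hqX => ?_⟩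
  · rw [← D.sum_coord_smul y (hv y hy).1,
      D.sum_verts hF.1 fun x hx => by rw [hXF y hy x hx, zero_smul]]
    exact sum_int_smul_mem Λ hFΛ (hv y hy).2
  obtain ⟨u, uX, u1, hu⟩ := exists_weights_of_mem_affineSpan hqX
  let b : E → ℝ := fun x => ∑ y ∈ X, u y * D.coord y x
  have bF : ∀ x, x ∉ F → b x = 0 := fun x hx =>
    Finset.sum_eq_zero fun y hy => by rw [hXF y hy x hx, mul_zero]
  have b1 : ∑ x ∈ F, b x = c := by
    rw [← D.sum_verts hF.1 bF, D.sum_sum_coord hX.1, u1, one_mul]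
  have bq : ∑ x ∈ F, b x • x = q := by
    rw [← D.sum_verts hF.1 fun x hx => by rw [bF x hx, zero_smul], D.sum_smul_eq hX.1, hu]
  have hne : F.Nonempty := by
    rw [Finset.nonempty_iff_ne_empty]
    rintro rfl
    rw [Finset.sum_empty] at b1
    exact hc.ne (by exact_mod_cast b1)
  obtain ⟨v, hvF⟩ := hne
  let b' : E → ℝ := fun x => b x - if x = v then ((c - 1 : ℤ) : ℝ) else 0
  have b'1 : ∑ x ∈ F, b' x = 1 := by
    simp [b', Finset.sum_sub_distrib, b1, hvF]
  have b'q : ∑ x ∈ F, b' x • x = q - (c - 1 : ℤ) • v := by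
    simp only [b', sub_smul, Finset.sum_sub_distrib, bq, ite_smul, zero_smul, Finset.sum_ite_eq',
      if_pos hvF, Int.cast_smul_eq_zsmul]
  obtain ⟨m, -, m1, hm⟩ := hFl _ (Λ.sub_mem hq (Λ.zsmul_mem (hFΛ v hvF) (c - 1)))
    (b'q ▸ sum_smul_mem_affineSpan b'1)
  have hbm := weights_unique hFi (u := b') (w := fun x => m x)
    (by rw [b'1]; exact_mod_cast m1.symm) (b'q.trans hm.symm)
  have hb : ∀ x, b x ∈ (Int.castAddHom ℝ).range := fun x => by
    by_cases hx : x ∈ F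
    · refine ⟨m x + if x = v then (c - 1 : ℤ) else 0, ?_⟩
      have := hbm x hx
      simp only [b'] at this
      rw [Int.coe_castAddHom]
      split_ifs at this ⊢ <;> push_cast at this ⊢ <;> linarith
    · rw [bF x hx]
      exact zero_mem _
  have hint := mem_of_interlaced (X := X) (s := D.seq) (n := D.verts.card) (w := u)
    (Int.castAddHom ℝ).range hi (fun y _ => D.seq_zero y)
    (fun y hy z hz hyz => (hv y hy).ext (hv z hz) hyz) (by rw [u1]; exact ⟨1, by simp⟩)
    (fun k _ => by
      have h : ∑ y ∈ X, u y * (D.seq y k : ℝ) = D.psum b k := by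
        rw [psum_sum]
        exact Finset.sum_congr rfl fun y hy => by rw [(hv y hy).seq_eq]
      rw [h]
      exact AddSubgroup.sum_mem _ fun i _ => hb _)
  have hint' : ∀ y, ∃ z : ℤ, u y = z := fun y => by
    by_cases hy : y ∈ X
    · obtain ⟨z, hz⟩ := hint y hy
      exact ⟨z, hz.symm⟩
    · exact ⟨0, by rw [uX y hy, Int.cast_zero]⟩
  choose z hz using hint'
  simp only [hz] at uX u1 hu
  exact ⟨z, fun y hy => by exact_mod_cast uX y hy, by exact_mod_cast u1, hu⟩

end DilationCoords

end Unimodular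

section RegularDilation

open Filter

variable {E : Type*} [NormedAddCommGroup E] [NormedSpace ℝ E] {P : Set E} {T : Finset (Finset E)}
  {c : ℕ}

namespace DilationCoords

variable (D : DilationCoords P T c)

theorem sum_inv_mul_coord (hc : 0 < c) {y : E} (hy : y ∈ dilate c P) :
    ∑ x ∈ D.verts, (c : ℝ)⁻¹ * D.coord y x = 1 := by
  rw [← Finset.mul_sum, D.sum_coord y hy, inv_mul_cancel₀ (by exact_mod_cast hc.ne')]

theorem exists_affineMap_eq_sum_coord (hc : 0 < c) (g : E →ᵃ[ℝ] ℝ) :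
    ∃ g' : E →ᵃ[ℝ] ℝ, ∀ y ∈ dilate c P,
      g' y = ∑ x ∈ D.verts, (c : ℝ)⁻¹ * D.coord y x * g x := by
  refine ⟨g.comp (LinearMap.lsmul ℝ E (c : ℝ)⁻¹).toAffineMap, fun y hy => ?_⟩
  have h := AffineMap.apply_sum_smul g D.verts (fun x => (c : ℝ)⁻¹ * D.coord y x) id
    (D.sum_inv_mul_coord hc hy)
  simp only [mul_smul, ← Finset.smul_sum, id] at h
  rw [D.sum_coord_smul y hy] at h
  exact h

theorem exists_affineMap_eq_spreadMinorant [FiniteDimensional ℝ E] (hc : 0 < c) {F : Finset E}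
    (hF : AffineIndependent ℝ (fun p : F => (p : E))) (a : ℕ → ℕ → ℤ) :
    ∃ k : E →ᵃ[ℝ] ℝ, ∀ y ∈ dilate c P, (∀ x, x ∉ F → D.coord y x = 0) →
      k y = spreadMinorant D.verts.card a (D.psum (D.coord y)) := by
  classical
  let δ : E → E → ℝ := fun x x' => if x' = x then (c : ℝ) else 0
  obtain ⟨g, hg⟩ := exists_affineMap_eq hF
    fun x => spreadMinorant D.verts.card a (D.psum (δ x))
  obtain ⟨k, hk⟩ := D.exists_affineMap_eq_sum_coord hc g
  refine ⟨k, fun y hy hyF => ?_⟩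
  have hδ : D.psum (D.coord y) =
      fun k => ∑ x ∈ D.verts, ((c : ℝ)⁻¹ * D.coord y x) * D.psum (δ x) k := by
    funext k
    rw [← psum_sum]
    congr 1
    funext x'
    have hc' : (c : ℝ) ≠ 0 := by exact_mod_cast hc.ne'
    simp only [δ, mul_ite, mul_zero, Finset.sum_ite_eq]
    split_ifs with hx
    · field_simp
    · obtain ⟨G, hG, hyG⟩ := D.coord_carrier y hy
      exact hyG x' fun h => hx (D.subset_verts G hG h)
  rw [hk y hy, hδ, spreadMinorant_sum a (D.sum_inv_mul_coord hc hy)]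
  refine Finset.sum_congr rfl fun x _ => ?_
  by_cases hx : x ∈ F
  · rw [hg x hx]
  · simp [hyF x hx]

theorem exists_support_of_maxCell [FiniteDimensional ℝ E] (hT : IsTriangulation P T) (hc : 0 < c)
    {X : Finset E} (hX : MaxCell D.cells X) :
    ∃ (F : Finset E) (k : E →ᵃ[ℝ] ℝ), MaxCell T F ∧ (∀ y ∈ X, ∀ x, x ∉ F → D.coord y x = 0) ∧
      (∀ y ∈ X, k y = spread D.verts.card (fun i => D.seq y i)) ∧
      ∀ y, D.IsVertex y → y ∉ X → (∀ x, x ∉ F → D.coord y x = 0) →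
        k y < spread D.verts.card (fun i => D.seq y i) := by
  classical
  obtain ⟨hv, ⟨G, hG, hXG⟩, hi⟩ := D.mem_cells.1 hX.1
  obtain ⟨F, hF, hGF⟩ := exists_maxCell_superset hG
  have hXF : ∀ y ∈ X, ∀ x, x ∉ F → D.coord y x = 0 := fun y hy x hx =>
    hXG y hy x fun h => hx (hGF h)
  obtain ⟨a, ha⟩ := exists_window hi
  obtain ⟨k, hk⟩ := D.exists_affineMap_eq_spreadMinorant hc (hT.affineIndependent hF.1) a
  have hk' : ∀ y, D.IsVertex y → (∀ x, x ∉ F → D.coord y x = 0) →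
      k y = spreadMinorant D.verts.card a (fun i => D.seq y i) := fun y hy hyF => by
    rw [hk y hy.1 hyF]
    congr 1
    funext i
    exact (hy.seq_eq i).symm
  refine ⟨F, k, hF, hXF, fun y hy => ?_, fun y hy hyX hyF => ?_⟩
  · rw [hk' y (hv y hy) (hXF y hy)]
    exact (spreadMinorant_eq_iff a _).2 (ha y hy)
  · rw [hk' y hy hyF]
    refine lt_of_le_of_ne (spreadMinorant_le a _) fun heq => hyX ?_
    have hya := (spreadMinorant_eq_iff a _).1 heq
    have hw : ∀ z ∈ insert y X, ∀ i ≤ D.verts.card, ∀ j ≤ D.verts.card,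
        D.seq z i - D.seq z j = a i j ∨ D.seq z i - D.seq z j = a i j + 1 := by
      simpa [Finset.forall_mem_insert] using ⟨hya, ha⟩
    have hmem : insert y X ∈ D.cells := D.mem_cells.2
      ⟨by simpa [Finset.forall_mem_insert] using ⟨hy, hv⟩,
        ⟨F, hF.1, by simpa [Finset.forall_mem_insert] using ⟨hyF, hXF⟩⟩,
        fun z hz z' hz' => interlaced_of_window (hw z hz) (hw z' hz')⟩
    exact hX.2 _ hmem (Finset.subset_insert y X) ▸ Finset.mem_insert_self y X

theorem isRegularTri_cells [FiniteDimensional ℝ E] (hT : IsTriangulation P T) (hc : 0 < c)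
    (hP : P.Nonempty) (hreg : IsRegularTri P T) : IsRegularTri (dilate c P) D.cells := by
  classical
  obtain ⟨f, hf, hlin, hdist⟩ := hreg
  choose! g hgF hglt using fun F (hF : MaxCell T F) => hT.exists_strict_support hf hlin hdist hF
  choose! F k hF hXF hkX hklt using
    fun X (hX : MaxCell D.cells X) => D.exists_support_of_maxCell hT hc hX
  choose g' hg' using fun F => D.exists_affineMap_eq_sum_coord hc (g F)
  let S : E → ℝ := fun y => spread D.verts.card (fun i => D.seq y i)
  let φ : E → ℝ := fun y => ∑ x ∈ D.verts, (c : ℝ)⁻¹ * D.coord y x * f x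
  have hgap : ∀ F y, y ∈ dilate c P → φ y - g' F y =
      ∑ x ∈ D.verts, (c : ℝ)⁻¹ * D.coord y x * (f x - g F x) := fun F y hy => by
    rw [hg' F y hy, ← Finset.sum_sub_distrib]
    exact Finset.sum_congr rfl fun x _ => by ring
  have hsupp : ∀ y ∈ dilate c P, ∀ x, D.coord y x ≠ 0 → {x} ∈ T := fun y hy x hx => by
    obtain ⟨G, hG, hyG⟩ := D.coord_carrier y hy
    exact hT.singleton_mem hG (by_contra fun h => hx (hyG x h))
  have hterm : ∀ F y, MaxCell T F → y ∈ dilate c P → ∀ x,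
      0 ≤ (c : ℝ)⁻¹ * D.coord y x * (f x - g F x) ∧
        (x ∉ F → D.coord y x ≠ 0 → 0 < (c : ℝ)⁻¹ * D.coord y x * (f x - g F x)) := by
    intro F y hF hy x
    have hpos : x ∉ F → D.coord y x ≠ 0 → 0 < (c : ℝ)⁻¹ * D.coord y x * (f x - g F x) :=
      fun hx h => by
        have h1 := lt_of_le_of_ne (D.coord_nonneg y hy x) (Ne.symm h)
        have h2 := sub_pos.2 (hglt F hF x (hsupp y hy x h) hx)
        have h3 : (0 : ℝ) < c := by exact_mod_cast hc
        positivity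
    refine ⟨?_, hpos⟩
    by_cases hx : x ∈ F
    · rw [hgF F hF x hx, sub_self, mul_zero]
    · by_cases h : D.coord y x = 0
      · rw [h, mul_zero, zero_mul]
      · exact (hpos hx h).le
  have hgap_nonneg : ∀ F y, MaxCell T F → y ∈ dilate c P → 0 ≤ φ y - g' F y :=
    fun F y hF hy => by
      rw [hgap F y hy]
      exact Finset.sum_nonneg fun x _ => (hterm F y hF hy x).1
  have hgap_eq : ∀ F y, MaxCell T F → y ∈ dilate c P →
      (φ y - g' F y = 0 ↔ ∀ x, x ∉ F → D.coord y x = 0) := by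
    intro F y hF hy
    rw [hgap F y hy]
    constructor
    · intro h x hx
      by_contra hne
      obtain ⟨G, hG, hyG⟩ := D.coord_carrier y hy
      have hxv := D.subset_verts G hG (by_contra fun h => hne (hyG x h))
      exact ((hterm F y hF hy x).2 hx hne).ne' ((Finset.sum_eq_zero_iff_of_nonneg
        fun x _ => (hterm F y hF hy x).1).1 h x hxv)
    · intro h
      refine Finset.sum_eq_zero fun x _ => ?_
      by_cases hx : x ∈ F
      · rw [hgF F hF x hx, sub_self, mul_zero]
      · rw [h x hx, mul_zero, zero_mul]
  obtain ⟨M, hM⟩ : ∃ M : ℝ, ∀ X ∈ D.cells, ∀ y ∈ D.finite_isVertex.toFinset,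
      0 < φ y - g' (F X) y → k X y < M * (φ y - g' (F X) y) + S y := by
    refine Eventually.exists (f := atTop) ?_
    rw [eventually_all_finset]
    intro X _
    rw [eventually_all_finset]
    intro y _
    rw [eventually_imp_distrib_left]
    intro h
    filter_upwards [eventually_gt_atTop ((k X y - S y) / (φ y - g' (F X) y))] with M hM
    rw [div_lt_iff₀ h] at hM
    linarith
  refine (D.isTriangulation_cells hT hc).isRegularTri_of_strict_support (hf.1.smul (c : ℝ))
    (hP.image _) (ω := fun y => M * φ y + S y) fun X hX => ?_
  have hv := (D.mem_cells.1 hX.1).1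
  refine ⟨M • g' (F X) + k X, fun y hy => ?_, fun y hy hyX => ?_⟩
  · have h := (hgap_eq _ y (hF X hX) (hv y hy).1).2 (hXF X hX y hy)
    simp only [AffineMap.coe_add, AffineMap.coe_smul, Pi.add_apply, Pi.smul_apply, smul_eq_mul]
    rw [hkX X hX y hy, ← sub_eq_zero.1 h]
  · have hyv := D.singleton_mem_cells.1 hy
    simp only [AffineMap.coe_add, AffineMap.coe_smul, Pi.add_apply, Pi.smul_apply, smul_eq_mul]
    rcases (hgap_nonneg _ y (hF X hX) hyv.1).eq_or_lt with h | h
    · have := hklt X hX y hyv hyX ((hgap_eq _ y (hF X hX) hyv.1).1 h.symm)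
      rw [← sub_eq_zero.1 h.symm]
      simp only [S]
      linarith
    · have := hM X hX.1 y (by simpa using hyv) h
      linarith

end DilationCoords

end RegularDilation

section Flag

/-- In a flag complex, a set all of whose pairs are faces is a face. -/
theorem IsFlag.mem_of_pairs {E : Type*} {T : Finset (Finset E)} (hT : IsFlag T) {A : Finset E}
    (hA : ∀ x ∈ A, ∀ y ∈ A, ∃ F ∈ T, x ∈ F ∧ y ∈ F)
    (hdown : ∀ F ∈ T, ∀ G, G ⊆ F → G ∈ T) : A ∈ T := by
  classical
  induction A using Finset.strongInduction with
  | H A ih =>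
    by_contra hAT
    have hmin : MinNonFace T A := by
      refine ⟨fun x hx => ?_, hAT, fun M hM => ih M hM fun x hx y hy =>
        hA x (hM.1 hx) y (hM.1 hy)⟩
      obtain ⟨F, hF, hxF, -⟩ := hA x hx x hx
      exact hdown F hF _ (by simpa using hxF)
    obtain ⟨x, y, -, rfl⟩ := Finset.card_eq_two.1 (hT A hmin)
    obtain ⟨F, hF, hxF, hyF⟩ := hA x (by simp) y (by simp)
    exact hAT (hdown F hF _ (by simp [Finset.insert_subset_iff, hxF, hyF]))

variable {E : Type*} [NormedAddCommGroup E] [NormedSpace ℝ E] {P : Set E} {T : Finset (Finset E)}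
  {c : ℕ}

namespace DilationCoords

variable (D : DilationCoords P T c)

theorem isFlag_cells (hT : IsTriangulation P T) (hflag : IsFlag T) :
    IsFlag D.cells := by
  classical
  rintro N ⟨hN1, hN, hNlt⟩
  by_contra hcard
  have hpair : ∀ y ∈ N, ∀ z ∈ N, {y, z} ∈ D.cells := fun y hy z hz => by
    rcases (show ({y, z} : Finset E) ⊆ N by
      simp [Finset.insert_subset_iff, hy, hz]).eq_or_ssubset with h | h
    · by_cases hyz : y = z
      · subst hyz
        simpa using hN1 y hy
      · exact absurd (h ▸ Finset.card_pair hyz) hcard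
    · exact hNlt _ h
  refine hN (D.mem_cells.2 ⟨fun y hy => D.singleton_mem_cells.1 (hN1 y hy), ?_, fun y hy z hz =>
    (D.mem_cells.1 (hpair y hy z hz)).2.2 y (by simp) z (by simp)⟩)
  refine ⟨D.verts.filter fun x => ∃ y ∈ N, D.coord y x ≠ 0, hflag.mem_of_pairs ?_ hT.2.1, ?_⟩
  · intro x hx x' hx'
    obtain ⟨-, y, hy, hyx⟩ := Finset.mem_filter.1 hx
    obtain ⟨-, z, hz, hzx⟩ := Finset.mem_filter.1 hx'
    obtain ⟨-, ⟨F, hF, h⟩, -⟩ := D.mem_cells.1 (hpair y hy z hz)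
    exact ⟨F, hF, by_contra fun hn => hyx (h y (by simp) x hn),
      by_contra fun hn => hzx (h z (by simp) x' hn)⟩
  · intro y hy x hx
    by_contra hne
    obtain ⟨F, hF, h⟩ := D.coord_carrier y (D.singleton_mem_cells.1 (hN1 y hy)).1
    exact hx (Finset.mem_filter.2 ⟨D.subset_verts F hF (by_contra fun hn => hne (h x hn)), y, hy,
      hne⟩)

end DilationCoords

end Flag

/-- The standard lattice as an additive subgroup. -/
def latticeSubgroup (d : ℕ) : AddSubgroup (Fin d → ℝ) :=
  AddSubgroup.pi Set.univ fun _ => (Int.castAddHom ℝ).range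

theorem zd_eq_mem_latticeSubgroup {d : ℕ} :
    (Zd : (Fin d → ℝ) → Prop) = (· ∈ latticeSubgroup d) := by
  funext x
  exact propext ⟨fun h i _ => (h i).imp fun _ hz => hz.symm,
    fun h i => (h i trivial).imp fun _ hz => hz.symm⟩

/-- **Dilations of triangulated polytopes.** Let `P` be a lattice polytope and `c` a
positive integer.  If `P` has a unimodular triangulation then so does `cP`; if moreover
the triangulation of `P` is regular, `cP` admits a regular unimodular triangulation; and
if it is quadratic (regular, unimodular and flag), then `cP` also admits a quadratic
triangulation. -/
theorem dilation_preserves_unimodular_triangulations {d : ℕ}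
    (P : Set (Fin d → ℝ)) (hP : IsLatticePolytope Zd P) (c : ℕ) (hc : 0 < c) :
    ((∃ T, IsTriangulation P T ∧ IsUnimodular Zd T) →
      ∃ T' : Finset (Finset (Fin d → ℝ)),
        IsTriangulation ((fun x => (c : ℝ) • x) '' P) T' ∧ IsUnimodular Zd T') ∧
    ((∃ T, IsTriangulation P T ∧ IsUnimodular Zd T ∧ IsRegularTri P T) →
      ∃ T' : Finset (Finset (Fin d → ℝ)),
        IsTriangulation ((fun x => (c : ℝ) • x) '' P) T' ∧ IsUnimodular Zd T' ∧
        IsRegularTri ((fun x => (c : ℝ) • x) '' P) T') ∧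
    ((∃ T, IsTriangulation P T ∧ IsUnimodular Zd T ∧ IsRegularTri P T ∧ IsFlag T) →
      ∃ T' : Finset (Finset (Fin d → ℝ)),
        IsTriangulation ((fun x => (c : ℝ) • x) '' P) T' ∧ IsUnimodular Zd T' ∧
        IsRegularTri ((fun x => (c : ℝ) • x) '' P) T' ∧ IsFlag T') := by
  have hne : P.Nonempty := by
    obtain ⟨V, hV, -, rfl⟩ := hP
    exact hV.to_set.mono (subset_convexHull ℝ _)
  rw [zd_eq_mem_latticeSubgroup]
  refine ⟨?_, ?_, ?_⟩
  · rintro ⟨T, hT, hU⟩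
    obtain ⟨D⟩ := hT.nonempty_dilationCoords c
    exact ⟨D.cells, D.isTriangulation_cells hT hc, D.isUnimodular_cells _ hT hc hU⟩
  · rintro ⟨T, hT, hU, hR⟩
    obtain ⟨D⟩ := hT.nonempty_dilationCoords c
    exact ⟨D.cells, D.isTriangulation_cells hT hc, D.isUnimodular_cells _ hT hc hU,
      D.isRegularTri_cells hT hc hne hR⟩
  · rintro ⟨T, hT, hU, hR, hflag⟩
    obtain ⟨D⟩ := hT.nonempty_dilationCoords c
    exact ⟨D.cells, D.isTriangulation_cells hT hc, D.isUnimodular_cells _ hT hc hU,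
      D.isRegularTri_cells hT hc hne hR, D.isFlag_cells hT hflag⟩
end

section
/- Let Δ be a lattice simplex of normalized volume V with respect to a lattice Λ. Then: (1) Δ has a unique face F₀ that is minimal under inclusion among the faces of Δ whose relative normalized volume equals V; in fact, the intersection of any two faces of relative normalized volume V again has relative normalized volume V. (2) If V is prime, then every proper face of F₀ is unimodular, and every nonzero box point of F₀ is non-degenerate, i.e. all of its barycentric coordinates with respect to the vertices of F₀ are non-integral. -/
/-- The set of differences of points of the finite set `F`. -/
def diffSet {E : Type*} [AddCommGroup E] (F : Finset E) : Set E :=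
  {v | ∃ a ∈ F, ∃ b ∈ F, v = a - b}

/-- The linear lattice `⃗L_F` generated by the differences of the vertices of `F`. -/
def vecLat {E : Type*} [AddCommGroup E] (F : Finset E) : AddSubgroup E :=
  AddSubgroup.closure (diffSet F)

/-- `Λ_F`: the intersection of the lattice `Λ` with the linear space parallel to `F`. -/
def latF {E : Type*} [AddCommGroup E] [Module ℝ E] (Λ : AddSubgroup E) (F : Finset E) :
    AddSubgroup E :=
  Λ ⊓ (Submodule.span ℝ (diffSet F)).toAddSubgroup

/-- The relative normalized volume of the face with vertex set `F`: the index
`[Λ_F : ⃗L_F]`, so that unimodular faces have relative normalized volume `1`. -/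
noncomputable def relVol {E : Type*} [AddCommGroup E] [Module ℝ E]
    (Λ : AddSubgroup E) (F : Finset E) : ℕ :=
  ((vecLat F).addSubgroupOf (latF Λ F)).index

/-- `m` is a non-degenerate box point of the face with (affinely independent) vertex set
`F`: none of the barycentric coordinates of `m` with respect to the vertices of `F` is an
integer. -/
def NonDegBox {E : Type*} [AddCommGroup E] [Module ℝ E] (F : Finset E) (m : E) : Prop :=
  ∀ c : E → ℝ, (∀ a, a ∉ F → c a = 0) → (∑ a ∈ F, c a) = 0 → (∑ a ∈ F, c a • a) = m →
    ∀ a ∈ F, ¬ ∃ z : ℤ, c a = (z : ℝ)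

theorem mem_span_diffSet_iff {R E : Type*} [Ring R] [AddCommGroup E] [Module R E]
    (F : Finset E) (m : E) :
    m ∈ Submodule.span R (diffSet F) ↔
      ∃ c : E → R, (∀ a, a ∉ F → c a = 0) ∧ ∑ a ∈ F, c a = 0 ∧ ∑ a ∈ F, c a • a = m := by
  classical
  constructor
  · intro h
    induction h using Submodule.span_induction with
    | mem x hx =>
      obtain ⟨a, ha, b, hb, rfl⟩ := hx
      refine ⟨Pi.single a 1 - Pi.single b 1, fun x hx => ?_, ?_, ?_⟩
      · have h₁ : x ≠ a := fun h => hx (h ▸ ha)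
        have h₂ : x ≠ b := fun h => hx (h ▸ hb)
        simp [h₁, h₂]
      · simp [Finset.sum_sub_distrib, ha, hb]
      · simp [sub_smul, Finset.sum_sub_distrib, Pi.single_apply, ite_smul, ha, hb]
    | zero => exact ⟨0, by simp⟩
    | add x y _ _ hx hy =>
      obtain ⟨c, hc, hc0, rfl⟩ := hx
      obtain ⟨d, hd, hd0, rfl⟩ := hy
      exact ⟨c + d, fun a ha => by simp [hc a ha, hd a ha],
        by simp [Finset.sum_add_distrib, hc0, hd0],
        by simp [add_smul, Finset.sum_add_distrib]⟩
    | smul r x _ hx =>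
      obtain ⟨c, hc, hc0, rfl⟩ := hx
      exact ⟨r • c, fun a ha => by simp [hc a ha],
        by simp [← Finset.mul_sum, hc0], by simp [mul_smul, Finset.smul_sum]⟩
  · rintro ⟨c, -, hc0, rfl⟩
    obtain rfl | ⟨b, hb⟩ := F.eq_empty_or_nonempty
    · simp
    · have : ∑ a ∈ F, c a • a = ∑ a ∈ F, c a • (a - b) := by
        simp [smul_sub, Finset.sum_sub_distrib, ← Finset.sum_smul, hc0]
      rw [this]
      exact Submodule.sum_mem _ fun a ha =>
        Submodule.smul_mem _ _ (Submodule.subset_span ⟨a, ha, b, hb, rfl⟩)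

theorem mem_vecLat_iff {E : Type*} [AddCommGroup E] (F : Finset E) (m : E) :
    m ∈ vecLat F ↔
      ∃ c : E → ℤ, (∀ a, a ∉ F → c a = 0) ∧ ∑ a ∈ F, c a = 0 ∧ ∑ a ∈ F, c a • a = m := by
  rw [← mem_span_diffSet_iff, vecLat, ← Submodule.span_int_eq_addSubgroupClosure,
    Submodule.mem_toAddSubgroup]

theorem mem_latF_iff {E : Type*} [AddCommGroup E] [Module ℝ E] (Λ : AddSubgroup E)
    (F : Finset E) (m : E) :
    m ∈ latF Λ F ↔ m ∈ Λ ∧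
      ∃ c : E → ℝ, (∀ a, a ∉ F → c a = 0) ∧ ∑ a ∈ F, c a = 0 ∧ ∑ a ∈ F, c a • a = m := by
  rw [← mem_span_diffSet_iff, latF, AddSubgroup.mem_inf, Submodule.mem_toAddSubgroup]

theorem diffSet_mono {E : Type*} [AddCommGroup E] {F W : Finset E} (h : F ⊆ W) :
    diffSet F ⊆ diffSet W := by
  rintro _ ⟨a, ha, b, hb, rfl⟩
  exact ⟨a, h ha, b, h hb, rfl⟩

theorem latF_mono {E : Type*} [AddCommGroup E] [Module ℝ E] (Λ : AddSubgroup E)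
    {F W : Finset E} (h : F ⊆ W) : latF Λ F ≤ latF Λ W :=
  inf_le_inf_left _ (Submodule.span_mono (diffSet_mono h))

theorem vecLat_le_latF {E : Type*} [AddCommGroup E] [Module ℝ E] {Λ : AddSubgroup E}
    {F : Finset E} (h : ∀ w ∈ F, w ∈ Λ) : vecLat F ≤ latF Λ F := by
  refine le_inf ?_ ?_
  · rw [vecLat, AddSubgroup.closure_le]
    rintro _ ⟨a, ha, b, hb, rfl⟩
    exact Λ.sub_mem (h a ha) (h b hb)
  · rw [vecLat, AddSubgroup.closure_le]
    exact Submodule.subset_span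

/-- Barycentric coordinates supported on faces of a simplex are unique. -/
theorem AffineIndependent.coord_unique {E : Type*} [AddCommGroup E] [Module ℝ E]
    {W : Finset E} (hind : AffineIndependent ℝ (fun p : W => (p : E))) {c d : E → ℝ}
    (hc : ∑ a ∈ W, c a = 0) (hd : ∑ a ∈ W, d a = 0)
    (h : ∑ a ∈ W, c a • a = ∑ a ∈ W, d a • a) : ∀ a ∈ W, c a = d a := by
  intro a ha
  have key := (affineIndependent_iff.mp hind) Finset.univ (fun p => c p - d p)
    (by rw [Finset.sum_coe_sort W (fun a => c a - d a), Finset.sum_sub_distrib, hc, hd, sub_zero])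
    (by rw [Finset.sum_coe_sort W (fun a => (c a - d a) • a)]
        simp [sub_smul, Finset.sum_sub_distrib, h])
    ⟨a, ha⟩ (Finset.mem_univ _)
  exact sub_eq_zero.mp key

/-- A lattice vector parallel to `W` is congruent modulo `vecLat W` to one parallel to the face `F`
exactly when its coordinates at the vertices outside `F` are integers. -/
theorem mem_latF_sup_vecLat_iff {E : Type*} [AddCommGroup E] [Module ℝ E] {Λ : AddSubgroup E}
    {F W : Finset E} (hW : ∀ w ∈ W, w ∈ Λ)
    (hind : AffineIndependent ℝ (fun p : W => (p : E))) (hF : F ⊆ W)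
    {c : E → ℝ} (hc : ∑ a ∈ W, c a = 0) (hm : ∑ a ∈ W, c a • a ∈ Λ) :
    ∑ a ∈ W, c a • a ∈ latF Λ F ⊔ vecLat W ↔ ∀ a ∈ W, a ∉ F → ∃ z : ℤ, c a = z := by
  classical
  constructor
  · intro h a ha haF
    obtain ⟨x, hx, y, hy, hxy⟩ := AddSubgroup.mem_sup.mp h
    obtain ⟨-, d, hd, hd0, rfl⟩ := (mem_latF_iff _ _ _).mp hx
    obtain ⟨z, -, hz0, rfl⟩ := (mem_vecLat_iff _ _).mp hy
    rw [Finset.sum_subset hF fun a _ ha => hd a ha] at hd0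
    rw [Finset.sum_subset hF fun a _ ha => by rw [hd a ha, zero_smul]] at hxy
    have hz0' : ∑ a ∈ W, (z a : ℝ) = 0 := by exact_mod_cast hz0
    have := hind.coord_unique (c := c) (d := fun a => d a + z a) hc
      (by rw [Finset.sum_add_distrib, hd0, hz0', add_zero])
      (by simp [← hxy, add_smul, Finset.sum_add_distrib, Int.cast_smul_eq_zsmul]) a ha
    exact ⟨z a, by rw [this, hd a haF, zero_add]⟩
  · intro h
    obtain ⟨z, hz0, hz⟩ : ∃ z : E → ℤ, ∑ a ∈ W, z a = 0 ∧ ∀ a ∈ W, a ∉ F → c a = z a := by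
      choose! z hz using h
      obtain rfl | ⟨b, hb⟩ := F.eq_empty_or_nonempty
      · refine ⟨z, ?_, hz⟩
        have : ∑ a ∈ W, (z a : ℝ) = 0 := by
          rw [← hc]
          exact Finset.sum_congr rfl fun a ha => (hz a ha (Finset.notMem_empty a)).symm
        exact_mod_cast this
      · refine ⟨z - Pi.single b (∑ a ∈ W, z a), ?_, fun a ha haF => ?_⟩
        · simp [Finset.sum_sub_distrib, hF hb]
        · have : a ≠ b := fun h => haF (h ▸ hb)
          simp [this, hz a ha haF]
    have hy : ∑ a ∈ W, z a • a ∈ vecLat W := by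
      refine (mem_vecLat_iff _ _).mpr ⟨fun a => if a ∈ W then z a else 0, ?_, ?_, ?_⟩
      · intro a ha; simp [ha]
      · rw [← hz0]; exact Finset.sum_congr rfl fun a ha => by simp [ha]
      · exact Finset.sum_congr rfl fun a ha => by simp [ha]
    have hz0' : ∑ a ∈ W, (z a : ℝ) = 0 := by exact_mod_cast hz0
    have hvanish : ∀ a ∈ W, a ∉ F → c a - z a = 0 := fun a ha haF => sub_eq_zero.mpr (hz a ha haF)
    refine AddSubgroup.mem_sup.mpr ⟨∑ a ∈ W, c a • a - ∑ a ∈ W, z a • a, ?_, _, hy,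
      sub_add_cancel _ _⟩
    refine (mem_latF_iff _ _ _).mpr ⟨Λ.sub_mem hm (vecLat_le_latF hW hy).1,
      fun a => if a ∈ F then c a - z a else 0, fun a ha => by simp [ha], ?_, ?_⟩
    · rw [Finset.sum_congr rfl fun a ha => if_pos ha, Finset.sum_subset hF hvanish,
        Finset.sum_sub_distrib, hc, hz0', sub_zero]
    · trans ∑ a ∈ F, (c a - z a) • a
      · exact Finset.sum_congr rfl fun a ha => by simp [ha]
      rw [Finset.sum_subset hF fun a ha haF => by rw [hvanish a ha haF, zero_smul]]
      simp [sub_smul, Finset.sum_sub_distrib, Int.cast_smul_eq_zsmul]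

theorem vecLat_inf_latF {E : Type*} [AddCommGroup E] [Module ℝ E] {Λ : AddSubgroup E}
    {F W : Finset E} (hW : ∀ w ∈ W, w ∈ Λ)
    (hind : AffineIndependent ℝ (fun p : W => (p : E))) (hF : F ⊆ W) :
    vecLat W ⊓ latF Λ F = vecLat F := by
  refine le_antisymm ?_ (le_inf (AddSubgroup.closure_mono (diffSet_mono hF))
    (vecLat_le_latF fun w hw => hW w (hF hw)))
  rintro _ ⟨hm, hm'⟩
  obtain ⟨z, -, hz0, rfl⟩ := (mem_vecLat_iff _ _).mp hm
  obtain ⟨-, d, hd, hd0, hdz⟩ := (mem_latF_iff _ _ _).mp hm'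
  rw [Finset.sum_subset hF fun a _ ha => hd a ha] at hd0
  rw [Finset.sum_subset hF fun a _ ha => by rw [hd a ha, zero_smul]] at hdz
  have hz0' : ∑ a ∈ W, (z a : ℝ) = 0 := by exact_mod_cast hz0
  have heq := hind.coord_unique (c := fun a => (z a : ℝ)) (d := d) hz0' hd0
    (by simp [hdz, Int.cast_smul_eq_zsmul])
  have hvanish : ∀ a ∈ W, a ∉ F → z a = 0 := fun a ha haF => by
    have := heq a ha
    rw [hd a haF] at this
    exact_mod_cast this
  classical
  refine (mem_vecLat_iff _ _).mpr ⟨fun a => if a ∈ F then z a else 0, fun a ha => by simp [ha],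
    ?_, ?_⟩
  · rw [Finset.sum_congr rfl fun a ha => if_pos ha, Finset.sum_subset hF hvanish, hz0]
  · trans ∑ a ∈ F, z a • a
    · exact Finset.sum_congr rfl fun a ha => by simp [ha]
    rw [Finset.sum_subset hF fun a ha haF => by rw [hvanish a ha haF, zero_smul]]

/-- The relative normalized volume of a face times the index of the image of its box points among
those of the simplex is the normalized volume of the simplex. -/
theorem relVol_mul_relIndex {E : Type*} [AddCommGroup E] [Module ℝ E] {Λ : AddSubgroup E}
    {F W : Finset E} (hW : ∀ w ∈ W, w ∈ Λ)
    (hind : AffineIndependent ℝ (fun p : W => (p : E))) (hF : F ⊆ W) :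
    relVol Λ F * (latF Λ F ⊔ vecLat W).relIndex (latF Λ W) = relVol Λ W := by
  have h : relVol Λ F = (vecLat W).relIndex (latF Λ F ⊔ vecLat W) := by
    rw [AddSubgroup.relIndex_sup_right, ← AddSubgroup.inf_relIndex_right,
      vecLat_inf_latF hW hind hF]
    rfl
  rw [h, AddSubgroup.relIndex_mul_relIndex _ _ _ le_sup_right
    (sup_le (latF_mono Λ hF) (vecLat_le_latF hW))]
  rfl

theorem relVol_eq_iff_forall_coord_integral {E : Type*} [AddCommGroup E] [Module ℝ E]
    {Λ : AddSubgroup E} {F W : Finset E} (hW : ∀ w ∈ W, w ∈ Λ)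
    (hind : AffineIndependent ℝ (fun p : W => (p : E))) (hpos : 0 < relVol Λ W) (hF : F ⊆ W) :
    relVol Λ F = relVol Λ W ↔ ∀ a ∈ W, a ∉ F → ∀ c : E → ℝ, ∑ a ∈ W, c a = 0 →
      ∑ a ∈ W, c a • a ∈ Λ → ∃ z : ℤ, c a = z := by
  classical
  have hmul := relVol_mul_relIndex hW hind hF
  have h₁ : relVol Λ F = relVol Λ W ↔ latF Λ W ≤ latF Λ F ⊔ vecLat W := by
    rw [← AddSubgroup.relIndex_eq_one]
    constructor
    · intro h
      rw [h] at hmul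
      exact Nat.eq_of_mul_eq_mul_left hpos (by rw [hmul, mul_one])
    · intro h
      rw [← hmul, h, mul_one]
  rw [h₁]
  constructor
  · intro h a ha haF c hc hm
    refine (mem_latF_sup_vecLat_iff hW hind hF hc hm).mp (h ?_) a ha haF
    refine (mem_latF_iff _ _ _).mpr ⟨hm, fun a => if a ∈ W then c a else 0,
      fun a ha => by simp [ha], ?_, ?_⟩
    · rw [Finset.sum_congr rfl fun a ha => if_pos ha, hc]
    · exact Finset.sum_congr rfl fun a ha => by simp [ha]
  · intro h m hm
    obtain ⟨hmΛ, c, -, hc, rfl⟩ := (mem_latF_iff _ _ _).mp hm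
    exact (mem_latF_sup_vecLat_iff hW hind hF hc hmΛ).mpr fun a ha haF => h a ha haF c hc hmΛ

/-- **The minimal face of maximal volume and its box points.** Let `Δ` be a simplex with
vertex set `W ⊆ Λ` of normalized volume `V` with respect to the lattice `Λ`.  Then:
(1) any two faces of relative normalized volume `V` intersect in a face of relative
normalized volume `V`; in particular `Δ` has a unique minimal face `F₀` of relative
normalized volume `V`.  (2) If `V` is prime, then every proper face of `F₀` is
unimodular, and every nonzero box point of `F₀` is non-degenerate. -/
theorem minimal_face_of_maximal_volume {n : ℕ} (Λ : AddSubgroup (Fin n → ℝ))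
    (hdisc : DiscreteTopology Λ)
    (W : Finset (Fin n → ℝ)) (hWlat : ∀ w ∈ W, w ∈ Λ)
    (hind : AffineIndependent ℝ (fun p : W => (p : Fin n → ℝ)))
    (V : ℕ) (hV : relVol Λ W = V) (hVpos : 0 < V) :
    -- (1) unique minimal face of relative volume V
    ((∀ G₁ G₂ : Finset (Fin n → ℝ), G₁ ⊆ W → G₂ ⊆ W →
        relVol Λ G₁ = V → relVol Λ G₂ = V → relVol Λ (G₁ ∩ G₂) = V) ∧
      ∃ F₀ : Finset (Fin n → ℝ), F₀ ⊆ W ∧ relVol Λ F₀ = V ∧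
        ∀ G, G ⊆ W → relVol Λ G = V → F₀ ⊆ G) ∧
    -- (2) prime volume: proper faces of F₀ unimodular, nonzero box points non-degenerate
    (V.Prime →
      ∀ F₀ : Finset (Fin n → ℝ), F₀ ⊆ W → relVol Λ F₀ = V →
        (∀ G, G ⊆ W → relVol Λ G = V → F₀ ⊆ G) →
        ((∀ G, G ⊂ F₀ → relVol Λ G = 1) ∧
          ∀ m, m ∈ latF Λ F₀ → m ∉ vecLat F₀ → NonDegBox F₀ m)) := by
  classical
  subst hV
  have crit {F} (hF : F ⊆ W) := relVol_eq_iff_forall_coord_integral hWlat hind hVpos hF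
  refine ⟨⟨?_, ?_⟩, ?_⟩
  · intro G₁ G₂ h₁ h₂ hG₁ hG₂
    rw [crit h₁] at hG₁
    rw [crit h₂] at hG₂
    rw [crit (fun a ha => h₁ (Finset.mem_inter.mp ha).1)]
    intro a ha haG
    by_cases haG₁ : a ∈ G₁
    · exact hG₂ a ha fun haG₂ => haG (Finset.mem_inter.mpr ⟨haG₁, haG₂⟩)
    · exact hG₁ a ha haG₁
  · refine ⟨W.filter fun a => ¬ ∀ c : (Fin n → ℝ) → ℝ, ∑ a ∈ W, c a = 0 →
      ∑ a ∈ W, c a • a ∈ Λ → ∃ z : ℤ, c a = z, Finset.filter_subset _ _, ?_, ?_⟩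
    · rw [crit (Finset.filter_subset _ _)]
      intro a ha haF
      by_contra hcon
      exact haF (Finset.mem_filter.mpr ⟨ha, hcon⟩)
    · intro G hG hvol a ha
      rw [crit hG] at hvol
      obtain ⟨haW, hcon⟩ := Finset.mem_filter.mp ha
      by_contra haG
      exact hcon (hvol a haW haG)
  · intro hp F₀ hF₀ _ hmin
    have unimod : ∀ G, G ⊂ F₀ → relVol Λ G = 1 := fun G hG =>
      ((Nat.dvd_prime hp).mp
        ⟨_, (relVol_mul_relIndex hWlat hind (hG.subset.trans hF₀)).symm⟩).resolve_right
        fun h => hG.not_subset (hmin G (hG.subset.trans hF₀) h)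
    refine ⟨unimod, ?_⟩
    rintro m hm hmL c hc hc0 rfl a ha ⟨z, hz⟩
    apply hmL
    have hG := Finset.erase_ssubset ha
    have hGW := hG.subset.trans hF₀
    have hle : latF Λ (F₀.erase a) ≤ vecLat (F₀.erase a) :=
      AddSubgroup.relIndex_eq_one.mp (unimod _ hG)
    rw [← vecLat_inf_latF hWlat hind hF₀]
    refine ⟨?_, hm⟩
    have hsup : latF Λ (F₀.erase a) ⊔ vecLat W ≤ vecLat W :=
      sup_le (hle.trans (AddSubgroup.closure_mono (diffSet_mono hGW))) le_rfl
    apply hsup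
    have hmΛ := hm.1
    rw [Finset.sum_subset hF₀ fun a _ ha => by rw [hc a ha, zero_smul]] at hmΛ ⊢
    rw [Finset.sum_subset hF₀ fun a _ ha => hc a ha] at hc0
    refine (mem_latF_sup_vecLat_iff hWlat hind hGW hc0 hmΛ).mpr fun b hb hbG => ?_
    by_cases hba : b = a
    · exact ⟨z, hba ▸ hz⟩
    · exact ⟨0, by rw [hc b fun hbF => hbG (Finset.mem_erase.mpr ⟨hba, hbF⟩), Int.cast_zero]⟩
end
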